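/- Let d ≥ 2 and let w be a doubling weight on S^{d-1} normalized by w(S^{d-1}) = 1. Then there exists a constant K_w > 0, depending only on d and the doubling constant of w, such that for every positive integer n and every integer N satisfying N ≥ K_w / w(B(x, 1/n)) for all x ∈ S^{d-1}, there exist N distinct points z_1, …, z_N ∈ S^{d-1} such that ∫_{S^{d-1}} P(x) w(x) dσ_d(x) = (1/N) · Σ_{j=1}^N P(z_j) for every P ∈ Π_n^d. -/

import Mathlib

open MeasureTheory Real Set
open scoped InnerProductSpace

noncomputable section

variable {d : ℕ}

/-- The unit sphere `S^{d-1}` of `ℝ^d`. -/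
def unitSphere (d : ℕ) : Set (EuclideanSpace ℝ (Fin d)) :=
  Metric.sphere (0 : EuclideanSpace ℝ (Fin d)) 1

/-- The geodesic distance `dist(x,y) = arccos (x ⬝ y)`. -/
def gdist (x y : EuclideanSpace ℝ (Fin d)) : ℝ := Real.arccos ⟪x, y⟫_ℝ

/-- The spherical cap with center `x` and radius `r`. -/
def cap (x : EuclideanSpace ℝ (Fin d)) (r : ℝ) : Set (EuclideanSpace ℝ (Fin d)) :=
  {y ∈ unitSphere d | gdist x y ≤ r}

/-- The surface Lebesgue measure on the unit sphere, realized as the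
`(d-1)`-dimensional Hausdorff measure restricted to the sphere. -/
def sphMeasure (d : ℕ) : Measure (EuclideanSpace ℝ (Fin d)) :=
  (Measure.hausdorffMeasure ((d : ℝ) - 1)).restrict (unitSphere d)

/-- `w(A) = ∫_A w dσ_d`. -/
def wMass (w : EuclideanSpace ℝ (Fin d) → ℝ) (A : Set (EuclideanSpace ℝ (Fin d))) : ℝ :=
  ∫ x in A, w x ∂(sphMeasure d)

/-- Evaluation of a `d`-variate real polynomial at a point of `ℝ^d`. -/
def pEval (P : MvPolynomial (Fin d) ℝ) (x : EuclideanSpace ℝ (Fin d)) : ℝ :=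
  MvPolynomial.eval (fun i => x i) P

/-- The geodesic arc joining `x` and `y`. -/
def arcSeg (x y : EuclideanSpace ℝ (Fin d)) : Set (EuclideanSpace ℝ (Fin d)) :=
  {z ∈ unitSphere d | ∃ t₁ t₂ : ℝ, 0 ≤ t₁ ∧ 0 ≤ t₂ ∧ z = t₁ • x + t₂ • y}

/-- Geodesic convexity of a subset of the sphere. -/
def GeoConvex (A : Set (EuclideanSpace ℝ (Fin d))) : Prop :=
  ∀ x ∈ A, ∀ y ∈ A, arcSeg x y ⊆ A

/-- The interior of a subset of the sphere relative to the sphere. -/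
def sphInterior (A : Set (EuclideanSpace ℝ (Fin d))) : Set (EuclideanSpace ℝ (Fin d)) :=
  {x ∈ A | ∃ ε : ℝ, 0 < ε ∧ Metric.ball x ε ∩ unitSphere d ⊆ A}

/-- The geodesic simplex spanned by `ξ 0, …, ξ (d-1)`. -/
def geodSimplex (ξ : Fin d → EuclideanSpace ℝ (Fin d)) :
    Set (EuclideanSpace ℝ (Fin d)) :=
  {z | ∃ t : Fin d → ℝ, (∀ j, 0 ≤ t j) ∧ (∑ j, t j) = 1 ∧
    z = ‖∑ j, t j • ξ j‖⁻¹ • ∑ j, t j • ξ j}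

/-- An admissible family `ξ 0, …, ξ (d-1)` of points of the sphere (the indices
`0, 1, …, d-1` correspond to `ξ_1, ξ_2, …, ξ_d` in the paper). -/
def Admissible (ξ : Fin d → EuclideanSpace ℝ (Fin d)) : Prop :=
  LinearIndependent ℝ ξ ∧ (∀ j, ξ j ∈ unitSphere d) ∧
  (∀ i j : Fin d, 1 ≤ (i : ℕ) → 1 ≤ (j : ℕ) → i ≠ j → ⟪ξ i, ξ j⟫_ℝ = 0) ∧
  (∀ i j : Fin d, (i : ℕ) = 0 → (j : ℕ) = 1 →
    Real.arccos ⟪ξ i, ξ j⟫_ℝ ∈ Set.Icc (π / 6) (π / 2)) ∧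
  (∀ i j : Fin d, (i : ℕ) = 0 → 2 ≤ (j : ℕ) → ⟪ξ i, ξ j⟫_ℝ = 0)

/-- A strongly `ε`-separated family of points of the sphere. -/
def StronglySep (ε : ℝ) (η : Fin d → EuclideanSpace ℝ (Fin d)) : Prop :=
  Function.Injective η ∧ (∀ j, η j ∈ unitSphere d) ∧
  ∀ j : Fin d, ∀ y ∈ Submodule.span ℝ (η '' {i | i ≠ j}), ε ≤ ‖η j - y‖

/-- The reflection negating the last coordinate. -/
def lastNeg (d : ℕ) (x : EuclideanSpace ℝ (Fin d)) : EuclideanSpace ℝ (Fin d) :=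
  (EuclideanSpace.equiv (Fin d) ℝ).symm fun i => if (i : ℕ) = d - 1 then -(x i) else x i

/-- The gradient of a `d`-variate polynomial, as a vector of `ℝ^d`. -/
def polyGrad (P : MvPolynomial (Fin d) ℝ) (x : EuclideanSpace ℝ (Fin d)) :
    EuclideanSpace ℝ (Fin d) :=
  (EuclideanSpace.equiv (Fin d) ℝ).symm fun i =>
    MvPolynomial.eval (fun j => x j) (MvPolynomial.pderiv i P)

/-- The tangential gradient `∇₀P(x) = ∇P(x) − (x⬝∇P(x))·x`. -/
def tGrad (P : MvPolynomial (Fin d) ℝ) (x : EuclideanSpace ℝ (Fin d)) :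
    EuclideanSpace ℝ (Fin d) :=
  polyGrad P x - ⟪x, polyGrad P x⟫_ℝ • x

/-- The affine hyperplane through the points `ξ j`. -/
def hplane (ξ : Fin d → EuclideanSpace ℝ (Fin d)) : Set (EuclideanSpace ℝ (Fin d)) :=
  (affineSpan ℝ (Set.range ξ) : Set (EuclideanSpace ℝ (Fin d)))

/-- The ball `B(x,r)_H = {y ∈ H : ‖x − y‖ ≤ r}` in a hyperplane `H`. -/
def ballH (H : Set (EuclideanSpace ℝ (Fin d))) (x : EuclideanSpace ℝ (Fin d)) (r : ℝ) :
    Set (EuclideanSpace ℝ (Fin d)) :=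
  {y ∈ H | ‖x - y‖ ≤ r}

/-- `w(A) = ∫_A w` with respect to `(d−1)`-dimensional Hausdorff (surface) measure. -/
def hMass (w : EuclideanSpace ℝ (Fin d) → ℝ) (A : Set (EuclideanSpace ℝ (Fin d))) : ℝ :=
  ∫ x in A, w x ∂(Measure.hausdorffMeasure ((d : ℝ) - 1))

/-- The interior of `A` relative to a hyperplane `H`. -/
def hInterior (H A : Set (EuclideanSpace ℝ (Fin d))) : Set (EuclideanSpace ℝ (Fin d)) :=
  {x ∈ A | ∃ ε : ℝ, 0 < ε ∧ Metric.ball x ε ∩ H ⊆ A}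

/-- A polynomial bounded by `M` on the unit circle is bounded by `M` on the unit disc. -/
theorem norm_eval_le_of_norm_le_one {p : Polynomial ℂ} {M : ℝ}
    (h : ∀ ζ : ℂ, ‖ζ‖ = 1 → ‖p.eval ζ‖ ≤ M) {ζ : ℂ} (hζ : ‖ζ‖ ≤ 1) : ‖p.eval ζ‖ ≤ M := by
  have hd : DiffContOnCl ℂ (fun z => p.eval z) (Metric.ball (0 : ℂ) 1) :=
    p.differentiable.diffContOnCl
  refine Complex.norm_le_of_forall_mem_frontier_norm_le (U := Metric.ball (0 : ℂ) 1)
    Metric.isBounded_ball hd ?_ ?_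
  · intro z hz
    rw [frontier_ball _ one_ne_zero] at hz
    exact h z (by simpa using hz)
  · rw [closure_ball _ one_ne_zero]
    simpa using hζ

/-- The Bernstein–Walsh growth bound outside the unit disc. -/
theorem norm_eval_le_mul_pow {p : Polynomial ℂ} {N : ℕ} (hp : p.natDegree ≤ N) {M : ℝ}
    (h : ∀ ζ : ℂ, ‖ζ‖ = 1 → ‖p.eval ζ‖ ≤ M) {ζ : ℂ} (hζ : 1 ≤ ‖ζ‖) :
    ‖p.eval ζ‖ ≤ M * ‖ζ‖ ^ N := by
  have key : ∀ z : ℂ, z ≠ 0 → p.eval z = z ^ N * (p.reflect N).eval z⁻¹ := by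
    intro z hz
    let u : Invertible z⁻¹ := invertibleOfNonzero (inv_ne_zero hz)
    have h1 := Polynomial.eval₂_reflect_mul_pow (RingHom.id ℂ) z⁻¹ N (p.reflect N)
      (le_trans (Polynomial.natDegree_reflect_le) (by simp [hp]))
    simp only [Polynomial.reflect_reflect, invOf_eq_inv, inv_inv] at h1
    rw [Polynomial.eval₂_id, Polynomial.eval₂_id] at h1
    rw [← h1, inv_pow]
    field_simp
  have hz : ζ ≠ 0 := by
    rintro rfl
    norm_num at hζ
  rw [key ζ hz, norm_mul, norm_pow, mul_comm]
  refine mul_le_mul_of_nonneg_right ?_ (by positivity)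
  refine norm_eval_le_of_norm_le_one (fun w hw => ?_) ?_
  · have hw0 : w ≠ 0 := by
      rintro rfl
      norm_num at hw
    have h2 := key w⁻¹ (inv_ne_zero hw0)
    have h3 := h w⁻¹ (by simp [hw])
    rw [h2, norm_mul] at h3
    simpa [hw] using h3
  · rw [norm_inv]
    exact inv_le_one_of_one_le₀ hζ

/-- Bernstein's inequality at the point `1`, with a non-sharp constant. -/
theorem norm_eval_derivative_one_le {p : Polynomial ℂ} {N : ℕ} (hN : 1 ≤ N)
    (hp : p.natDegree ≤ N) {M : ℝ} (h : ∀ ζ : ℂ, ‖ζ‖ = 1 → ‖p.eval ζ‖ ≤ M) :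
    ‖p.derivative.eval 1‖ ≤ 3 * N * M := by
  have hM : 0 ≤ M := le_trans (norm_nonneg _) (h 1 (by simp))
  have hN' : (0 : ℝ) < N := by exact_mod_cast hN
  have hb : ∀ z ∈ Metric.sphere (1 : ℂ) (1 / N), ‖p.eval z‖ ≤ 3 * M := by
    intro z hz
    rw [mem_sphere_iff_norm] at hz
    have hz1 : ‖z‖ ≤ 1 + 1 / N := by
      calc ‖z‖ = ‖1 + (z - 1)‖ := by ring_nf
        _ ≤ ‖(1 : ℂ)‖ + ‖z - 1‖ := norm_add_le _ _
        _ = 1 + 1 / N := by rw [hz]; simp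
    rcases le_total ‖z‖ 1 with h1 | h1
    · linarith [norm_eval_le_of_norm_le_one h h1]
    · have h2 := norm_eval_le_mul_pow hp h h1
      have h3 : ‖z‖ ^ N ≤ 3 := by
        calc ‖z‖ ^ N ≤ (Real.exp (1 / N)) ^ N := by
              refine pow_le_pow_left₀ (norm_nonneg _) (hz1.trans ?_) _
              linarith [Real.add_one_le_exp (1 / (N : ℝ))]
          _ = Real.exp 1 := by
              rw [← Real.exp_nat_mul]
              congr 1
              field_simp
          _ ≤ 3 := Real.exp_one_lt_three.le
      nlinarith
  have h4 := Complex.norm_deriv_le_of_forall_mem_sphere_norm_le (c := (1 : ℂ))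
    (R := 1 / N) (C := 3 * M) (f := fun z => p.eval z) (by positivity)
    p.differentiable.diffContOnCl hb
  rw [Polynomial.deriv] at h4
  refine h4.trans (le_of_eq ?_)
  field_simp

/-- The localizing multiplier `((1 + X + ⋯ + X ^ (n - 1)) / n) ^ A`. -/
def localizer (n A : ℕ) : Polynomial ℂ :=
  (Polynomial.C (n : ℂ)⁻¹ * ∑ k ∈ Finset.range n, Polynomial.X ^ k) ^ A

theorem natDegree_localizer_le (n A : ℕ) : (localizer n A).natDegree ≤ A * n := by
  refine Polynomial.natDegree_pow_le.trans (Nat.mul_le_mul_left _ ?_)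
  refine (Polynomial.natDegree_C_mul_le _ _).trans ?_
  refine Polynomial.natDegree_sum_le_of_forall_le _ _ fun k hk => ?_
  exact (Polynomial.natDegree_X_pow_le k).trans (Finset.mem_range.1 hk).le

theorem eval_one_localizer {n : ℕ} (hn : 0 < n) (A : ℕ) : (localizer n A).eval 1 = 1 := by
  have : (n : ℂ) ≠ 0 := by exact_mod_cast hn.ne'
  simp [localizer, Polynomial.eval_finsetSum, this]

theorem norm_eval_localizer_base {n : ℕ} (hn : 0 < n) {ζ : ℂ} (hζ : ‖ζ‖ = 1) :
    ‖(Polynomial.C (n : ℂ)⁻¹ * ∑ k ∈ Finset.range n, Polynomial.X ^ k).eval ζ‖ ≤ 1 ∧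
    ‖(Polynomial.C (n : ℂ)⁻¹ * ∑ k ∈ Finset.range n, Polynomial.X ^ k).eval ζ‖ *
      (1 + n * ‖1 - ζ‖) ≤ 3 := by
  have hn' : (0 : ℝ) < n := by exact_mod_cast hn
  set a := ‖(Polynomial.C (n : ℂ)⁻¹ * ∑ k ∈ Finset.range n, Polynomial.X ^ k).eval ζ‖ with ha
  have h0 : a = (n : ℝ)⁻¹ * ‖∑ k ∈ Finset.range n, ζ ^ k‖ := by
    simp [ha, Polynomial.eval_finsetSum]
  have h1 : a ≤ 1 := by
    have : ‖∑ k ∈ Finset.range n, ζ ^ k‖ ≤ n := by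
      refine (norm_sum_le _ _).trans ?_
      simp [hζ]
    rw [h0, inv_mul_le_iff₀ hn']
    linarith
  refine ⟨h1, ?_⟩
  have h2 : a * (n * ‖1 - ζ‖) ≤ 2 := by
    have h3 : ‖∑ k ∈ Finset.range n, ζ ^ k‖ * ‖1 - ζ‖ = ‖ζ ^ n - 1‖ := by
      rw [← geom_sum_mul, norm_mul, norm_sub_rev 1 ζ]
    have h4 : ‖ζ ^ n - 1‖ ≤ 2 := by
      refine (norm_sub_le _ _).trans ?_
      simp [hζ]
      norm_num
    calc a * (n * ‖1 - ζ‖) = ‖∑ k ∈ Finset.range n, ζ ^ k‖ * ‖1 - ζ‖ := by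
          rw [h0]; field_simp
      _ ≤ 2 := by rw [h3]; exact h4
  linarith

theorem norm_eval_localizer_le_one {n : ℕ} (hn : 0 < n) (A : ℕ) {ζ : ℂ} (hζ : ‖ζ‖ = 1) :
    ‖(localizer n A).eval ζ‖ ≤ 1 := by
  rw [localizer, Polynomial.eval_pow, norm_pow]
  exact pow_le_one₀ (norm_nonneg _) (norm_eval_localizer_base hn hζ).1

theorem norm_eval_localizer_mul_le {n : ℕ} (hn : 0 < n) (A : ℕ) {ζ : ℂ} (hζ : ‖ζ‖ = 1) :
    ‖(localizer n A).eval ζ‖ * (1 + n * ‖1 - ζ‖) ^ A ≤ 3 ^ A := by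
  rw [localizer, Polynomial.eval_pow, norm_pow, ← mul_pow]
  exact pow_le_pow_left₀ (by positivity) (norm_eval_localizer_base hn hζ).2 _

/-- A localized form of Bernstein's inequality. -/
theorem norm_eval_derivative_one_le_of_localized {p : Polynomial ℂ} {n : ℕ} (hn : 0 < n) (A : ℕ)
    (hp : p.natDegree ≤ 4 * n) {M : ℝ}
    (h : ∀ ζ : ℂ, ‖ζ‖ = 1 → ‖p.eval ζ‖ ≤ M * (1 + n * ‖1 - ζ‖) ^ A) :
    ‖p.derivative.eval 1‖ ≤ (3 * (A + 4) * 3 ^ A + 3 * (A + 4)) * n * M := by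
  have h1 : ‖p.eval 1‖ ≤ M := by simpa using h 1 (by simp)
  have hM : 0 ≤ M := (norm_nonneg _).trans h1
  set q := localizer n A
  have hq : ‖q.derivative.eval 1‖ ≤ 3 * ((A + 4) * n : ℕ) * 1 :=
    norm_eval_derivative_one_le (by nlinarith)
      ((natDegree_localizer_le n A).trans (by nlinarith))
      (fun ζ hζ => norm_eval_localizer_le_one hn A hζ)
  have hpq : ‖(p * q).derivative.eval 1‖ ≤ 3 * ((A + 4) * n : ℕ) * (3 ^ A * M) := by
    refine norm_eval_derivative_one_le (by nlinarith) ?_ ?_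
    · refine Polynomial.natDegree_mul_le.trans ?_
      have := natDegree_localizer_le n A
      change p.natDegree + (localizer n A).natDegree ≤ _
      nlinarith
    · intro ζ hζ
      rw [Polynomial.eval_mul, norm_mul]
      have h2 := norm_eval_localizer_mul_le hn A hζ
      calc ‖p.eval ζ‖ * ‖q.eval ζ‖ ≤ M * (1 + n * ‖1 - ζ‖) ^ A * ‖q.eval ζ‖ :=
            mul_le_mul_of_nonneg_right (h ζ hζ) (norm_nonneg _)
        _ = M * (‖q.eval ζ‖ * (1 + n * ‖1 - ζ‖) ^ A) := by ring
        _ ≤ M * 3 ^ A := mul_le_mul_of_nonneg_left h2 hM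
        _ = 3 ^ A * M := mul_comm _ _
  have h5 : p.derivative.eval 1 = (p * q).derivative.eval 1 - p.eval 1 * q.derivative.eval 1 := by
    rw [Polynomial.derivative_mul, Polynomial.eval_add, Polynomial.eval_mul, Polynomial.eval_mul,
      eval_one_localizer hn]
    ring
  rw [h5]
  refine (norm_sub_le _ _).trans ?_
  rw [norm_mul]
  push_cast at hq hpq
  have h6 : ‖p.eval 1‖ * ‖q.derivative.eval 1‖ ≤ M * (3 * ((A + 4) * n) * 1) :=
    mul_le_mul h1 hq (norm_nonneg _) hM
  nlinarith

/-- A polynomial restricted to a great circle is a trigonometric polynomial. -/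
theorem exists_circle_poly (P : MvPolynomial (Fin d) ℝ) {N : ℕ} (hP : P.totalDegree ≤ N)
    (x e : EuclideanSpace ℝ (Fin d)) :
    ∃ p : Polynomial ℂ, p.natDegree ≤ 2 * N ∧ ∀ t : ℝ,
      p.eval (Complex.exp (t * Complex.I)) =
        Complex.exp (t * Complex.I) ^ N * (pEval P (cos t • x + sin t • e) : ℂ) := by
  let l : Fin d → Polynomial ℂ := fun i =>
    Polynomial.C (x i / 2 : ℂ) * (Polynomial.X ^ 2 + 1) +
      Polynomial.C (e i / (2 * Complex.I) : ℂ) * (Polynomial.X ^ 2 - 1)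
  have hl : ∀ i, (l i).natDegree ≤ 2 := fun i => by
    simp only [l]
    compute_degree
  have hle : ∀ i (t : ℝ), (l i).eval (Complex.exp (t * Complex.I)) =
      Complex.exp (t * Complex.I) * ((cos t * x i + sin t * e i : ℝ) : ℂ) := by
    intro i t
    have hI := Complex.I_sq
    have h1 := Complex.sin_sq_add_cos_sq (t : ℂ)
    simp only [l, Polynomial.eval_add, Polynomial.eval_mul, Polynomial.eval_C, Polynomial.eval_sub,
      Polynomial.eval_pow, Polynomial.eval_X, Polynomial.eval_one]
    rw [Complex.exp_mul_I]
    push_cast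
    have h2 : (Complex.cos t + Complex.sin t * Complex.I) ^ 2 + 1 =
        2 * Complex.cos t * (Complex.cos t + Complex.sin t * Complex.I) := by
      linear_combination Complex.sin t ^ 2 * hI - h1
    have h3 : (Complex.cos t + Complex.sin t * Complex.I) ^ 2 - 1 =
        2 * Complex.I * Complex.sin t * (Complex.cos t + Complex.sin t * Complex.I) := by
      linear_combination -Complex.sin t ^ 2 * hI + h1
    rw [h2, h3]
    have := Complex.I_ne_zero
    field_simp
  have hdeg : ∀ m ∈ P.support, ∑ i, m i ≤ N := fun m hm => by
    have := MvPolynomial.le_totalDegree hm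
    rw [Finsupp.sum_fintype _ _ (fun _ => rfl)] at this
    exact this.trans hP
  refine ⟨∑ m ∈ P.support, Polynomial.C ((MvPolynomial.coeff m P : ℝ) : ℂ) *
    ((∏ i, l i ^ m i) * Polynomial.X ^ (N - ∑ i, m i)), ?_, ?_⟩
  · refine Polynomial.natDegree_sum_le_of_forall_le _ _ fun m hm => ?_
    refine (Polynomial.natDegree_C_mul_le _ _).trans (Polynomial.natDegree_mul_le.trans ?_)
    have h1 : (∏ i, l i ^ m i).natDegree ≤ 2 * ∑ i, m i := by
      refine (Polynomial.natDegree_prod_le _ _).trans ?_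
      rw [Finset.mul_sum]
      refine Finset.sum_le_sum fun i _ => Polynomial.natDegree_pow_le.trans ?_
      rw [mul_comm]
      exact Nat.mul_le_mul_right _ (hl i)
    have h2 := Polynomial.natDegree_X_pow_le (R := ℂ) (N - ∑ i, m i)
    have h3 := hdeg m hm
    omega
  · intro t
    rw [Polynomial.eval_finsetSum, pEval, MvPolynomial.eval_eq']
    push_cast
    rw [Finset.mul_sum]
    refine Finset.sum_congr rfl fun m hm => ?_
    simp only [Polynomial.eval_mul, Polynomial.eval_C, Polynomial.eval_prod, Polynomial.eval_pow,
      Polynomial.eval_X, hle, mul_pow, Finset.prod_mul_distrib, Finset.prod_pow_eq_pow_sum]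
    have h4 : Complex.exp (t * Complex.I) ^ N = Complex.exp (t * Complex.I) ^ (∑ i, m i) *
        Complex.exp (t * Complex.I) ^ (N - ∑ i, m i) := by
      rw [← pow_add, Nat.add_sub_cancel' (hdeg m hm)]
    rw [h4]
    simp
    ring

theorem hasFDerivAt_pEval (P : MvPolynomial (Fin d) ℝ) (x : EuclideanSpace ℝ (Fin d)) :
    HasFDerivAt (pEval P) (innerSL ℝ (polyGrad P x)) x := by
  have hg : ∀ (Q : MvPolynomial (Fin d) ℝ) i,
      polyGrad Q x i = MvPolynomial.eval (fun j => x j) (MvPolynomial.pderiv i Q) := fun _ _ => rfl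
  induction P using MvPolynomial.induction_on with
  | C a =>
    have h1 : pEval (d := d) (MvPolynomial.C a) = fun _ => a := by
      funext y; simp [pEval]
    have h2 : polyGrad (MvPolynomial.C a) x = 0 := by
      ext i; simp [hg]
    rw [h1, h2]
    simpa using hasFDerivAt_const a x
  | add p q hp hq =>
    have h1 : pEval (p + q) = pEval p + pEval q := by
      funext y; simp [pEval]
    have h2 : polyGrad (p + q) x = polyGrad p x + polyGrad q x := by
      ext i; simp [hg]
    rw [h1, h2, map_add]
    exact hp.add hq
  | mul_X p i hp =>
    have h1 : pEval (p * MvPolynomial.X i) = fun y => pEval p y * y i := by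
      funext y; simp [pEval]
    have h3 : HasFDerivAt (fun y : EuclideanSpace ℝ (Fin d) => y i)
        (EuclideanSpace.proj i : EuclideanSpace ℝ (Fin d) →L[ℝ] ℝ) x :=
      (EuclideanSpace.proj i : EuclideanSpace ℝ (Fin d) →L[ℝ] ℝ).hasFDerivAt
    rw [h1]
    refine (hp.mul h3).congr_fderiv ?_
    have h2 : polyGrad (p * MvPolynomial.X i) x =
        pEval p x • EuclideanSpace.single i 1 + x i • polyGrad p x := by
      ext j
      rw [hg, MvPolynomial.pderiv_mul]
      by_cases hij : j = i
      · subst hij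
        simp [hg, pEval]
        ring
      · simp [hg, hij, MvPolynomial.pderiv_X_of_ne (Ne.symm hij)]
        ring
    ext v
    rw [h2]
    simp [EuclideanSpace.inner_single_left]

theorem continuous_pEval (P : MvPolynomial (Fin d) ℝ) : Continuous (pEval P) :=
  continuous_iff_continuousAt.2 fun x => (hasFDerivAt_pEval P x).continuousAt

/-- The norm of a chord of a great circle. -/
theorem norm_sub_circle {x e : EuclideanSpace ℝ (Fin d)} (hx : ‖x‖ = 1) (he : ‖e‖ = 1)
    (hxe : ⟪x, e⟫_ℝ = 0) (t : ℝ) :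
    ‖cos t • x + sin t • e‖ = 1 ∧
      ‖x - (cos t • x + sin t • e)‖ = ‖1 - Complex.exp (t * Complex.I)‖ := by
  have hs : ∀ a b : ℝ, ‖a • x + b • e‖ ^ 2 = a ^ 2 + b ^ 2 := by
    intro a b
    rw [norm_add_sq_real, norm_smul, norm_smul, inner_smul_left, inner_smul_right, hxe, hx, he]
    simp
  constructor
  · have h := hs (cos t) (sin t)
    rw [cos_sq_add_sin_sq] at h
    exact (pow_eq_one_iff_of_nonneg (norm_nonneg _) two_ne_zero).1 h
  · have h1 : x - (cos t • x + sin t • e) = (1 - cos t) • x + (- sin t) • e := by module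
    rw [← sq_eq_sq₀ (norm_nonneg _) (norm_nonneg _), h1, hs, Complex.exp_mul_I, Complex.sq_norm,
      Complex.normSq_apply]
    simp [Complex.cos_ofReal_re, Complex.sin_ofReal_re]
    ring

/-- The constant of the localized Bernstein inequality on the sphere. -/
def bernsteinConst (A : ℕ) : ℝ := 3 * (A + 4) * 3 ^ A + 3 * (A + 4) + 2

theorem one_le_bernsteinConst (A : ℕ) : 1 ≤ bernsteinConst A := by
  unfold bernsteinConst
  have : (0 : ℝ) ≤ 3 * (A + 4) * 3 ^ A + 3 * (A + 4) := by positivity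
  linarith

theorem abs_inner_polyGrad_le {P : MvPolynomial (Fin d) ℝ} {n : ℕ} (hn : 0 < n) (A : ℕ)
    (hP : P.totalDegree ≤ 2 * n) {x e : EuclideanSpace ℝ (Fin d)} (hx : ‖x‖ = 1) (he : ‖e‖ = 1)
    (hxe : ⟪x, e⟫_ℝ = 0) {M : ℝ}
    (h : ∀ z, ‖z‖ = 1 → |pEval P z| ≤ M * (1 + n * ‖x - z‖) ^ A) :
    |⟪polyGrad P x, e⟫_ℝ| ≤ bernsteinConst A * n * M := by
  obtain ⟨p, hpd, hp⟩ := exists_circle_poly P hP x e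
  set E : ℝ → ℂ := fun t => Complex.exp (t * Complex.I) with hE
  have hE1 : ∀ t, ‖E t‖ = 1 := fun t => Complex.norm_exp_ofReal_mul_I t
  have hb : ∀ ζ : ℂ, ‖ζ‖ = 1 → ‖p.eval ζ‖ ≤ M * (1 + n * ‖1 - ζ‖) ^ A := by
    intro ζ hζ
    obtain ⟨t, rfl⟩ : ∃ t : ℝ, Complex.exp (t * Complex.I) = ζ :=
      (Complex.norm_eq_one_iff ζ).1 hζ
    obtain ⟨h1, h2⟩ := norm_sub_circle hx he hxe t
    rw [hp t, norm_mul, norm_pow, hE1, one_pow, one_mul, ← h2, Complex.norm_real]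
    exact h _ h1
  have hB := norm_eval_derivative_one_le_of_localized hn A (by omega) hb
  have hM1 : ‖p.eval 1‖ ≤ M := by simpa using hb 1 (by simp)
  have hdE : HasDerivAt E Complex.I 0 := by
    have h1 : HasDerivAt (fun t : ℝ => (t : ℂ) * Complex.I) Complex.I 0 := by
      simpa using (Complex.ofRealCLM.hasDerivAt (x := 0)).mul_const Complex.I
    simpa using h1.cexp
  have hE0 : E 0 = 1 := by simp [hE]
  have hcirc : HasDerivAt (fun t : ℝ => cos t • x + sin t • e) e 0 := by
    exact (((hasDerivAt_cos 0).smul_const x).add ((hasDerivAt_sin 0).smul_const e)).congr_deriv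
      (by simp)
  have hdP : HasDerivAt (fun t : ℝ => pEval P (cos t • x + sin t • e)) ⟪polyGrad P x, e⟫_ℝ 0 := by
    have h2 := hasFDerivAt_pEval P (cos 0 • x + sin 0 • e)
    have h3 := h2.comp_hasDerivAt (0 : ℝ) hcirc
    exact h3.congr_deriv (by simp)
  have hR : HasDerivAt (fun t : ℝ => E t ^ (2 * n) * (pEval P (cos t • x + sin t • e) : ℂ))
      ((2 * n : ℕ) * Complex.I * pEval P x + ⟪polyGrad P x, e⟫_ℝ) 0 := by
    have h4 := (hdE.pow (2 * n)).mul hdP.ofReal_comp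
    exact h4.congr_deriv (by simp [hE0])
  have hL : HasDerivAt (fun t : ℝ => p.eval (E t)) (p.derivative.eval 1 * Complex.I) 0 := by
    have h5 : HasDerivAt (fun z => p.eval z) (p.derivative.eval (E 0)) (E 0) := p.hasDerivAt _
    have h6 := h5.comp (0 : ℝ) hdE
    rw [hE0] at h6
    exact h6
  have heq : (fun t : ℝ => p.eval (E t)) =
      fun t : ℝ => E t ^ (2 * n) * (pEval P (cos t • x + sin t • e) : ℂ) := funext hp
  rw [heq] at hL
  have h7 := hL.unique hR
  have hP1 : |pEval P x| ≤ M := by simpa using h x hx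
  have h8 : ((⟪polyGrad P x, e⟫_ℝ : ℝ) : ℂ) =
      p.derivative.eval 1 * Complex.I - (2 * n : ℕ) * Complex.I * pEval P x := by
    rw [h7]; ring
  have h9 : |⟪polyGrad P x, e⟫_ℝ| ≤ ‖p.derivative.eval 1‖ + 2 * n * |pEval P x| := by
    rw [← Real.norm_eq_abs, ← Complex.norm_real, h8]
    refine (norm_sub_le _ _).trans (le_of_eq ?_)
    simp
  unfold bernsteinConst
  have hn' : (0 : ℝ) < n := by exact_mod_cast hn
  nlinarith

/-- `M` bounds `‖f z‖` on the sphere up to the polynomial growth factor `(1 + n ‖x - z‖) ^ A`. -/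
def LocBound (A n : ℕ) {F : Type*} [Norm F] (f : EuclideanSpace ℝ (Fin d) → F)
    (x : EuclideanSpace ℝ (Fin d)) (M : ℝ) : Prop :=
  ∀ z, ‖z‖ = 1 → ‖f z‖ ≤ M * (1 + n * ‖x - z‖) ^ A

theorem LocBound.nonneg {A n : ℕ} {F : Type*} [SeminormedAddCommGroup F]
    {f : EuclideanSpace ℝ (Fin d) → F} {x : EuclideanSpace ℝ (Fin d)} {M : ℝ}
    (h : LocBound A n f x M) (hx : ‖x‖ = 1) : 0 ≤ M := by
  have := (norm_nonneg _).trans (h x hx)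
  simpa using this

theorem LocBound.translate {A n : ℕ} {F : Type*} [SeminormedAddCommGroup F]
    {f : EuclideanSpace ℝ (Fin d) → F} {x y : EuclideanSpace ℝ (Fin d)} {M : ℝ}
    (h : LocBound A n f x M) (hx : ‖x‖ = 1) :
    LocBound A n f y (M * (1 + n * ‖x - y‖) ^ A) := by
  intro z hz
  refine (h z hz).trans ?_
  rw [mul_assoc, ← mul_pow]
  refine mul_le_mul_of_nonneg_left (pow_le_pow_left₀ (by positivity) ?_ _) (h.nonneg hx)
  have h1 : ‖x - z‖ ≤ ‖x - y‖ + ‖y - z‖ := by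
    simpa using norm_add_le (x - y) (y - z)
  have h2 : (0 : ℝ) ≤ n := Nat.cast_nonneg n
  have h3 : 0 ≤ (n * ‖x - y‖) * (n * ‖y - z‖) := by positivity
  nlinarith

theorem LocBound.near {A n : ℕ} {F : Type*} [SeminormedAddCommGroup F]
    {f : EuclideanSpace ℝ (Fin d) → F} {x y : EuclideanSpace ℝ (Fin d)} {M : ℝ}
    (h : LocBound A n f x M) (hx : ‖x‖ = 1) (hxy : n * ‖x - y‖ ≤ 1) :
    LocBound A n f y (2 ^ A * M) := by
  intro z hz
  refine (h.translate hx (y := y) z hz).trans ?_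
  refine mul_le_mul_of_nonneg_right ?_ (by positivity)
  rw [mul_comm]
  refine mul_le_mul_of_nonneg_right ?_ (h.nonneg hx)
  exact pow_le_pow_left₀ (by positivity) (by linarith) _

theorem inner_self_tGrad (P : MvPolynomial (Fin d) ℝ) {x : EuclideanSpace ℝ (Fin d)}
    (hx : ‖x‖ = 1) : ⟪x, tGrad P x⟫_ℝ = 0 := by
  rw [tGrad, inner_sub_right, inner_smul_right, real_inner_self_eq_norm_sq, hx]
  ring

/-- The localized Bernstein inequality for the tangential gradient. -/
theorem norm_tGrad_le {P : MvPolynomial (Fin d) ℝ} {n : ℕ} (hn : 0 < n) {A : ℕ}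
    (hP : P.totalDegree ≤ 2 * n) {x : EuclideanSpace ℝ (Fin d)} (hx : ‖x‖ = 1) {M : ℝ}
    (h : LocBound A n (pEval P) x M) : ‖tGrad P x‖ ≤ bernsteinConst A * n * M := by
  by_cases h0 : tGrad P x = 0
  · rw [h0, norm_zero]
    have := h.nonneg hx
    have := one_le_bernsteinConst A
    positivity
  · have h1 : ‖tGrad P x‖ ≠ 0 := norm_ne_zero_iff.2 h0
    set e := ‖tGrad P x‖⁻¹ • tGrad P x with he
    have hxe : ⟪x, e⟫_ℝ = 0 := by rw [he, inner_smul_right, inner_self_tGrad P hx, mul_zero]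
    have hee : ‖e‖ = 1 := by rw [he, norm_smul, norm_inv, norm_norm, inv_mul_cancel₀ h1]
    have h2 := abs_inner_polyGrad_le hn A hP hx hee hxe (M := M) (fun z hz => h z hz)
    have h3 : ⟪polyGrad P x, e⟫_ℝ = ‖tGrad P x‖ := by
      have h4 : polyGrad P x = tGrad P x + ⟪x, polyGrad P x⟫_ℝ • x := by simp [tGrad]
      rw [h4, inner_add_left, inner_smul_left, hxe, mul_zero, add_zero, he, inner_smul_right,
        real_inner_self_eq_norm_sq]
      field_simp
    rw [h3, abs_of_nonneg (norm_nonneg _)] at h2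
    exact h2

/-- The extension of `P` from the sphere that is homogeneous of degree zero. -/
def radial (P : MvPolynomial (Fin d) ℝ) (z : EuclideanSpace ℝ (Fin d)) : ℝ :=
  pEval P (‖z‖⁻¹ • z)

theorem norm_inv_norm_smul {z : EuclideanSpace ℝ (Fin d)} (hz : z ≠ 0) : ‖‖z‖⁻¹ • z‖ = 1 := by
  rw [norm_smul, norm_inv, norm_norm, inv_mul_cancel₀ (norm_ne_zero_iff.2 hz)]

theorem radial_of_norm_eq_one (P : MvPolynomial (Fin d) ℝ) {z : EuclideanSpace ℝ (Fin d)}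
    (hz : ‖z‖ = 1) : radial P z = pEval P z := by
  simp [radial, hz]

theorem hasFDerivAt_radial (P : MvPolynomial (Fin d) ℝ) {z : EuclideanSpace ℝ (Fin d)}
    (hz : z ≠ 0) :
    HasFDerivAt (radial P) (innerSL ℝ (‖z‖⁻¹ • tGrad P (‖z‖⁻¹ • z))) z := by
  have h0 : ‖z‖ ≠ 0 := norm_ne_zero_iff.2 hz
  have h1 : HasFDerivAt (fun y : EuclideanSpace ℝ (Fin d) => ‖y‖) (‖z‖⁻¹ • innerSL ℝ z) z := by
    have h2 := (hasStrictFDerivAt_norm_sq z).hasFDerivAt.sqrt (by positivity)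
    simp only [Real.sqrt_sq (norm_nonneg _)] at h2
    refine h2.congr_fderiv ?_
    ext v
    simp
    field_simp
  have h3 : HasFDerivAt (fun y : EuclideanSpace ℝ (Fin d) => ‖y‖⁻¹)
      (-(‖z‖ ^ 2)⁻¹ • (‖z‖⁻¹ • innerSL ℝ z)) z :=
    (hasDerivAt_inv h0).comp_hasFDerivAt z h1
  have h4 : HasFDerivAt (fun y : EuclideanSpace ℝ (Fin d) => ‖y‖⁻¹ • y)
      (‖z‖⁻¹ • ContinuousLinearMap.id ℝ (EuclideanSpace ℝ (Fin d)) +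
        (-(‖z‖ ^ 2)⁻¹ • (‖z‖⁻¹ • innerSL ℝ z)).smulRight z) z := h3.smul (hasFDerivAt_id z)
  refine (HasFDerivAt.comp (f := fun y : EuclideanSpace ℝ (Fin d) => ‖y‖⁻¹ • y) z
    (hasFDerivAt_pEval P (‖z‖⁻¹ • z)) h4).congr_fderiv ?_
  ext v
  simp only [tGrad, ContinuousLinearMap.comp_apply, innerSL_apply_apply, inner_add_right,
    add_apply, smul_apply, smul_eq_mul, inner_smul_left,
    inner_smul_right, inner_sub_left, ContinuousLinearMap.smulRight_apply,
    ContinuousLinearMap.id_apply, real_inner_comm z, RCLike.conj_to_real]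
  field_simp
  ring

theorem half_le_norm_add {x v : EuclideanSpace ℝ (Fin d)} (hx : ‖x‖ = 1) {r : ℝ} (hr : r ≤ 1 / 2)
    (hv : ‖v‖ ≤ r) : 1 / 2 ≤ ‖x + v‖ := by
  have := norm_sub_le (x + v) v
  simp only [add_sub_cancel_right, hx] at this
  linarith

theorem abs_norm_add_sub_one_le {x v : EuclideanSpace ℝ (Fin d)} (hx : ‖x‖ = 1) :
    |‖x + v‖ - 1| ≤ ‖v‖ := by
  have := abs_norm_sub_norm_le (x + v) x
  rwa [hx, add_sub_cancel_left] at this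

theorem norm_sub_normalize_le {x v : EuclideanSpace ℝ (Fin d)} (hx : ‖x‖ = 1)
    (h0 : x + v ≠ 0) : ‖x - ‖x + v‖⁻¹ • (x + v)‖ ≤ 2 * ‖v‖ := by
  have h1 : x - ‖x + v‖⁻¹ • (x + v) = (x + v - ‖x + v‖⁻¹ • (x + v)) - v := by abel
  have h2 : ‖x + v - ‖x + v‖⁻¹ • (x + v)‖ = |‖x + v‖ - 1| := by
    have h3 : x + v - ‖x + v‖⁻¹ • (x + v) = ((‖x + v‖ - 1) * ‖x + v‖⁻¹) • (x + v) := by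
      have : ‖x + v‖ ≠ 0 := norm_ne_zero_iff.2 h0
      rw [sub_mul, mul_inv_cancel₀ this, sub_smul, one_smul, one_mul]
    rw [h3, norm_smul, norm_mul, norm_inv, norm_norm, mul_assoc,
      inv_mul_cancel₀ (norm_ne_zero_iff.2 h0), mul_one, Real.norm_eq_abs]
  rw [h1]
  refine (norm_sub_le _ _).trans ?_
  rw [h2]
  linarith [abs_norm_add_sub_one_le (v := v) hx]

/-- A mean value inequality for `radial P` near a point of the sphere. -/
theorem abs_radial_sub_sub_inner_le (P : MvPolynomial (Fin d) ℝ)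
    {x g : EuclideanSpace ℝ (Fin d)} (hx : ‖x‖ = 1) {r C : ℝ} (hr : r ≤ 1 / 2)
    (h : ∀ v, ‖v‖ ≤ r → ‖‖x + v‖⁻¹ • tGrad P (‖x + v‖⁻¹ • (x + v)) - g‖ ≤ C)
    {v v' : EuclideanSpace ℝ (Fin d)} (hv : ‖v‖ ≤ r) (hv' : ‖v'‖ ≤ r) :
    |radial P (x + v) - radial P (x + v') - ⟪g, v - v'⟫_ℝ| ≤ C * ‖v - v'‖ := by
  have h1 : ∀ z ∈ Metric.closedBall x r, ∃ w, z = x + w ∧ ‖w‖ ≤ r := fun z hz =>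
    ⟨z - x, by abel, by simpa [dist_eq_norm] using hz⟩
  have h2 := (convex_closedBall x r).norm_image_sub_le_of_norm_hasFDerivWithin_le'
    (f := radial P) (f' := fun z => innerSL ℝ (‖z‖⁻¹ • tGrad P (‖z‖⁻¹ • z)))
    (φ := innerSL ℝ g) (C := C) (x := x + v') (y := x + v) ?_ ?_ (by simpa using hv')
    (by simpa using hv)
  · simpa [Real.norm_eq_abs] using h2
  · intro z hz
    obtain ⟨w, rfl, hw⟩ := h1 z hz
    refine (hasFDerivAt_radial P ?_).hasFDerivWithinAt
    have := half_le_norm_add hx hr hw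
    exact norm_pos_iff.1 (by linarith)
  · intro z hz
    obtain ⟨w, rfl, hw⟩ := h1 z hz
    rw [← map_sub, innerSL_apply_norm]
    exact h w hw

/-- Points `x + v` with `‖v‖ ≤ r` project to points of the sphere within `2r` of `x`. -/
theorem normalize_add {x v : EuclideanSpace ℝ (Fin d)} (hx : ‖x‖ = 1) {r : ℝ} (hr : r ≤ 1 / 2)
    (hv : ‖v‖ ≤ r) : ‖‖x + v‖⁻¹ • (x + v)‖ = 1 ∧ ‖x - ‖x + v‖⁻¹ • (x + v)‖ ≤ 2 * ‖v‖ ∧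
      ‖x + v‖⁻¹ ≤ 2 := by
  have h1 := half_le_norm_add hx hr hv
  have h2 : x + v ≠ 0 := norm_pos_iff.1 (by linarith)
  refine ⟨norm_inv_norm_smul h2, norm_sub_normalize_le hx h2, ?_⟩
  rw [inv_le_comm₀ (by linarith) (by norm_num)]
  linarith

theorem abs_radial_sub_le (P : MvPolynomial (Fin d) ℝ)
    {x : EuclideanSpace ℝ (Fin d)} (hx : ‖x‖ = 1) {r C : ℝ} (hr : r ≤ 1 / 2)
    (h : ∀ z, ‖z‖ = 1 → ‖x - z‖ ≤ 2 * r → ‖tGrad P z‖ ≤ C)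
    {v v' : EuclideanSpace ℝ (Fin d)} (hv : ‖v‖ ≤ r) (hv' : ‖v'‖ ≤ r) :
    |radial P (x + v) - radial P (x + v')| ≤ 2 * C * ‖v - v'‖ := by
  have := abs_radial_sub_sub_inner_le P hx (g := 0) (C := 2 * C) hr ?_ hv hv'
  · simpa using this
  · intro w hw
    obtain ⟨h1, h2, h3⟩ := normalize_add hx hr hw
    rw [sub_zero, norm_smul, norm_inv, norm_norm]
    exact mul_le_mul h3 (h _ h1 (h2.trans (by linarith))) (norm_nonneg _) zero_le_two

theorem abs_pEval_sub_le {P : MvPolynomial (Fin d) ℝ} {n : ℕ} (hn : 0 < n) {A : ℕ}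
    (hP : P.totalDegree ≤ 2 * n) {x y : EuclideanSpace ℝ (Fin d)} (hx : ‖x‖ = 1) (hy : ‖y‖ = 1)
    (hxy : n * ‖x - y‖ ≤ 1 / 2) {M : ℝ} (h : LocBound A n (pEval P) x M) :
    |pEval P x - pEval P y| ≤ 2 * (bernsteinConst A * n * (2 ^ A * M)) * ‖x - y‖ := by
  have hn' : (1 : ℝ) ≤ n := by exact_mod_cast hn
  have hr : ‖x - y‖ ≤ 1 / 2 := by nlinarith [norm_nonneg (x - y)]
  have := abs_radial_sub_le P hx hr (C := bernsteinConst A * n * (2 ^ A * M)) ?_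
    (v := 0) (v' := y - x) (by simp) (by rw [norm_sub_rev])
  · rwa [add_zero, add_sub_cancel, radial_of_norm_eq_one P hx, radial_of_norm_eq_one P hy,
      zero_sub, neg_sub] at this
  · intro z hz hxz
    refine norm_tGrad_le hn hP hz (h.near hx ?_)
    nlinarith

theorem totalDegree_pderiv_le (P : MvPolynomial (Fin d) ℝ) (i : Fin d) :
    (MvPolynomial.pderiv i P).totalDegree ≤ P.totalDegree - 1 := by
  conv_lhs => rw [P.as_sum, map_sum]
  refine MvPolynomial.totalDegree_finsetSum_le fun m hm => ?_
  rw [MvPolynomial.pderiv_monomial]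
  by_cases h0 : m i = 0
  · simp [h0]
  · refine (MvPolynomial.totalDegree_monomial_le _ _).trans ?_
    have h1 := MvPolynomial.le_totalDegree hm
    have h2 : (Finsupp.single i 1 + (m - Finsupp.single i 1)) = m :=
      add_tsub_cancel_of_le (Finsupp.single_le_iff.2 (Nat.one_le_iff_ne_zero.2 h0))
    rw [← h2, Finsupp.sum_add_index' (fun _ => rfl) (fun _ _ _ => rfl),
      Finsupp.sum_single_index rfl] at h1
    simp only [Finsupp.sum] at h1 ⊢
    simp only [Function.id_def] at *
    omega

/-- The polynomial representing a component of the tangential gradient. -/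
theorem exists_inner_tGrad_poly (P : MvPolynomial (Fin d) ℝ) {n : ℕ} (hn : 0 < n)
    (hP : P.totalDegree ≤ n) (a : EuclideanSpace ℝ (Fin d)) :
    ∃ H : MvPolynomial (Fin d) ℝ, H.totalDegree ≤ 2 * n ∧ ∀ x, pEval H x = ⟪a, tGrad P x⟫_ℝ := by
  have hpd : ∀ i, (MvPolynomial.pderiv i P).totalDegree ≤ n - 1 := fun i =>
    (totalDegree_pderiv_le P i).trans (by omega)
  refine ⟨∑ i, MvPolynomial.C (a i) * (MvPolynomial.pderiv i P - MvPolynomial.X i *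
    ∑ j, MvPolynomial.X j * MvPolynomial.pderiv j P), ?_, ?_⟩
  · refine MvPolynomial.totalDegree_finsetSum_le fun i _ => ?_
    have h1 : (∑ j, MvPolynomial.X j * MvPolynomial.pderiv j P).totalDegree ≤ n := by
      refine MvPolynomial.totalDegree_finsetSum_le fun j _ => ?_
      refine (MvPolynomial.totalDegree_mul _ _).trans ?_
      rw [MvPolynomial.totalDegree_X]
      have := hpd j
      omega
    refine (MvPolynomial.totalDegree_mul _ _).trans ?_
    rw [MvPolynomial.totalDegree_C, zero_add]
    refine (MvPolynomial.totalDegree_sub _ _).trans (max_le ((hpd i).trans (by omega)) ?_)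
    refine (MvPolynomial.totalDegree_mul _ _).trans ?_
    rw [MvPolynomial.totalDegree_X]
    omega
  · intro x
    simp only [tGrad, polyGrad, PiLp.inner_apply, pEval, map_sum, map_mul, map_sub,
      MvPolynomial.eval_C, MvPolynomial.eval_X]
    refine Finset.sum_congr rfl fun i _ => ?_
    simp only [PiLp.sub_apply, PiLp.smul_apply, smul_eq_mul, EuclideanSpace.equiv,
      PiLp.continuousLinearEquiv_symm_apply, RCLike.inner_apply, RCLike.conj_to_real]
    rw [mul_comm (a i), mul_comm (x i)]
    congr 3
    exact Finset.sum_congr rfl fun j _ => mul_comm _ _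

/-- The constant in the local estimates for tangential gradients of polynomials. -/
def gradConst (A : ℕ) : ℝ := 2 ^ (A + 1) * (1 + 2 * bernsteinConst A)

theorem one_le_gradConst (A : ℕ) : 1 ≤ gradConst A := by
  have h1 := one_le_bernsteinConst A
  have h2 : (1 : ℝ) ≤ 2 ^ (A + 1) := one_le_pow₀ (by norm_num)
  unfold gradConst
  nlinarith

theorem norm_tGrad_sub_le {P : MvPolynomial (Fin d) ℝ} {n : ℕ} (hn : 0 < n) {A : ℕ}
    (hP : P.totalDegree ≤ n) {x y : EuclideanSpace ℝ (Fin d)} (hx : ‖x‖ = 1) (hy : ‖y‖ = 1)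
    (hxy : n * ‖x - y‖ ≤ 1 / 2) {M : ℝ} (h : LocBound A n (tGrad P) x M) :
    ‖tGrad P x - tGrad P y‖ ≤ 2 * (bernsteinConst A * n * (2 ^ A * M)) * ‖x - y‖ := by
  set g := tGrad P x - tGrad P y with hg
  have hM := h.nonneg hx
  have hB := one_le_bernsteinConst A
  by_cases h0 : g = 0
  · rw [h0, norm_zero]
    positivity
  obtain ⟨H, hH, hHe⟩ := exists_inner_tGrad_poly P hn hP (‖g‖⁻¹ • g)
  have h1 := abs_pEval_sub_le hn hH hx hy hxy (A := A) (M := M) fun z hz => by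
    rw [hHe]
    refine (norm_inner_le_norm _ _).trans ?_
    rw [norm_inv_norm_smul h0, one_mul]
    exact h z hz
  rw [hHe, hHe, ← inner_sub_right, ← hg, inner_smul_left, real_inner_self_eq_norm_sq] at h1
  have h2 : ‖g‖ ≠ 0 := norm_ne_zero_iff.2 h0
  have h3 : (starRingEnd ℝ) ‖g‖⁻¹ * ‖g‖ ^ 2 = ‖g‖ := by
    simp
    field_simp
  rwa [h3, abs_of_nonneg (norm_nonneg _)] at h1

theorem LocBound.le_of_near {A n : ℕ} {F : Type*} [SeminormedAddCommGroup F]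
    {f : EuclideanSpace ℝ (Fin d) → F} {x z : EuclideanSpace ℝ (Fin d)} {M : ℝ}
    (h : LocBound A n f x M) (hx : ‖x‖ = 1) (hz : ‖z‖ = 1) (hxz : n * ‖x - z‖ ≤ 1) :
    ‖f z‖ ≤ 2 ^ A * M := by
  have := h.near hx hxz z hz
  simpa using this

theorem abs_radial_sub_sub_le {P : MvPolynomial (Fin d) ℝ} {n : ℕ} (hn : 0 < n) {A : ℕ}
    (hP : P.totalDegree ≤ n) {y : EuclideanSpace ℝ (Fin d)} (hy : ‖y‖ = 1) {M : ℝ}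
    (h : LocBound A n (tGrad P) y M) {r : ℝ} (hr : n * r ≤ 1 / 4)
    {v v' : EuclideanSpace ℝ (Fin d)} (hv : ‖v‖ ≤ r) (hv' : ‖v'‖ ≤ r) :
    |radial P (y + v) - radial P (y + v') - ⟪tGrad P y, v - v'⟫_ℝ| ≤
      gradConst A * n * r * M * ‖v - v'‖ := by
  have hn' : (1 : ℝ) ≤ n := by exact_mod_cast hn
  have hr0 : 0 ≤ r := (norm_nonneg v).trans hv
  have hr2 : r ≤ 1 / 4 := by nlinarith
  have hM := h.nonneg hy
  have hB := one_le_bernsteinConst A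
  refine abs_radial_sub_sub_inner_le P hy (by linarith) (fun w hw => ?_) hv hv'
  obtain ⟨h1, h2, h3⟩ := normalize_add hy (by linarith) hw
  set z := ‖y + w‖⁻¹ • (y + w) with hz
  have h4 : n * ‖y - z‖ ≤ 1 / 2 := by nlinarith
  have h5 := norm_tGrad_sub_le hn hP hy h1 h4 h
  have h6 := h.le_of_near hy h1 (by linarith)
  have h7 : |‖y + w‖⁻¹ - 1| ≤ 2 * r := by
    have h8 : ‖y + w‖ ≠ 0 := by
      have := half_le_norm_add hy (by linarith : r ≤ 1 / 2) hw
      linarith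
    have h9 : ‖y + w‖⁻¹ - 1 = ‖y + w‖⁻¹ * (1 - ‖y + w‖) := by
      field_simp
    rw [h9, abs_mul, abs_of_nonneg (by positivity : 0 ≤ ‖y + w‖⁻¹), abs_sub_comm]
    exact mul_le_mul h3 ((abs_norm_add_sub_one_le hy).trans hw) (abs_nonneg _) zero_le_two
  have h10 : ‖y + w‖⁻¹ • tGrad P z - tGrad P y =
      (‖y + w‖⁻¹ - 1) • tGrad P z - (tGrad P y - tGrad P z) := by
    rw [sub_smul, one_smul]; abel
  rw [h10]
  refine (norm_sub_le _ _).trans ?_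
  rw [norm_smul, Real.norm_eq_abs]
  have h11 : |‖y + w‖⁻¹ - 1| * ‖tGrad P z‖ ≤ 2 * r * (2 ^ A * M) :=
    mul_le_mul h7 h6 (norm_nonneg _) (by positivity)
  have h12 : 2 * r * (2 ^ A * M) ≤ n * (2 * r * (2 ^ A * M)) :=
    le_mul_of_one_le_left (by positivity) hn'
  have h13 : 2 * (bernsteinConst A * n * (2 ^ A * M)) * ‖y - z‖ ≤
      2 * (bernsteinConst A * n * (2 ^ A * M)) * (2 * r) :=
    mul_le_mul_of_nonneg_left (by linarith) (by positivity)
  unfold gradConst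
  rw [pow_succ]
  linarith

theorem abs_radial_sub_le_of_locBound {P : MvPolynomial (Fin d) ℝ} {n : ℕ} (hn : 0 < n) {A : ℕ}
    {y : EuclideanSpace ℝ (Fin d)} (hy : ‖y‖ = 1) {M : ℝ}
    (h : LocBound A n (tGrad P) y M) {r : ℝ} (hr : n * r ≤ 1 / 4)
    {v v' : EuclideanSpace ℝ (Fin d)} (hv : ‖v‖ ≤ r) (hv' : ‖v'‖ ≤ r) :
    |radial P (y + v) - radial P (y + v')| ≤ gradConst A * M * ‖v - v'‖ := by
  have hn' : (1 : ℝ) ≤ n := by exact_mod_cast hn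
  have hr0 : 0 ≤ r := (norm_nonneg v).trans hv
  have hM := h.nonneg hy
  have hB := one_le_bernsteinConst A
  refine (abs_radial_sub_le P hy (r := r) (C := 2 ^ A * M) (by nlinarith) ?_ hv hv').trans ?_
  · intro z hz hyz
    exact h.le_of_near hy hz (by nlinarith)
  · refine mul_le_mul_of_nonneg_right ?_ (norm_nonneg _)
    unfold gradConst
    have : 0 ≤ 2 ^ A * M * bernsteinConst A := by positivity
    rw [pow_succ]
    linarith

section Newton

theorem exists_zero_of_approximates {X Y : Type*} [NormedAddCommGroup X] [NormedSpace ℝ X]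
    [CompleteSpace X] [NormedAddCommGroup Y] [NormedSpace ℝ Y] (L : X →L[ℝ] Y) (R : Y → X)
    (hR : ∀ y, ‖R y‖ ≤ ‖y‖) (hLR : ∀ y, L (R y) = y) {F : X → Y} {ρ : ℝ} (hρ : 0 < ρ)
    (hF : ∀ v v', ‖v‖ ≤ ρ → ‖v'‖ ≤ ρ → ‖F v - F v' - L (v - v')‖ ≤ 1 / 2 * ‖v - v'‖)
    (h0 : ‖F 0‖ ≤ ρ / 2) : ∃ v, ‖v‖ ≤ ρ ∧ F v = 0 := by
  let R' : L.NonlinearRightInverse := ⟨R, 1, fun y => by simpa using hR y, hLR⟩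
  have hA : ApproximatesLinearOn F L (Metric.closedBall 0 ρ) (1 / 2) := by
    intro v hv v' hv'
    rw [mem_closedBall_zero_iff] at hv hv'
    simpa using hF v v' hv hv'
  have hS := hA.surjOn_closedBall_of_nonlinearRightInverse R' hρ.le subset_rfl
  have h1 : ((R'.nnnorm : ℝ)⁻¹ - ((1 / 2 : NNReal) : ℝ)) * ρ = ρ / 2 := by
    simp only [R', NNReal.coe_one, inv_one, NNReal.coe_div, NNReal.coe_ofNat]
    ring
  rw [h1] at hS
  obtain ⟨v, hv, hv0⟩ := hS (show (0 : Y) ∈ _ by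
    rwa [mem_closedBall_iff_norm, zero_sub, norm_neg])
  exact ⟨v, mem_closedBall_zero_iff.1 hv, hv0⟩

variable {ι E : Type*} [Fintype ι] [NormedAddCommGroup E] [InnerProductSpace ℝ E]
  [FiniteDimensional ℝ E]

/-- Every functional on a subspace of `ℓ¹(E)` comes from a vector of the same norm in `ℓ^∞(E)`. -/
theorem exists_pi_norm_le_of_dual (V : Submodule ℝ (PiLp 1 fun _ : ι => E))
    (φ : StrongDual ℝ V) :
    ∃ v : ι → E, ‖v‖ ≤ ‖φ‖ ∧ ∀ g : V, φ g = ∑ k, ⟪(g : PiLp 1 fun _ : ι => E) k, v k⟫_ℝ := by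
  classical
  obtain ⟨ψ, hψ, hn⟩ := exists_extension_norm_eq (𝕜 := ℝ) V φ
  let J : ι → E →ₗ[ℝ] PiLp 1 fun _ : ι => E := fun k =>
    (WithLp.linearEquiv 1 ℝ (ι → E)).symm.toLinearMap ∘ₗ LinearMap.single ℝ (fun _ : ι => E) k
  have hJ : ∀ k e, ‖J k e‖ = ‖e‖ := fun k e => by
    exact PiLp.norm_single 1 (fun _ : ι => E) k e
  let χ : ι → StrongDual ℝ E := fun k => LinearMap.mkContinuous (ψ.toLinearMap ∘ₗ J k) ‖ψ‖
    fun e => by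
      refine (ψ.le_opNorm (J k e)).trans ?_
      rw [hJ]
  have hχ : ∀ k, ‖χ k‖ ≤ ‖ψ‖ := fun k => LinearMap.mkContinuous_norm_le _ (norm_nonneg _) _
  refine ⟨fun k => (InnerProductSpace.toDual ℝ E).symm (χ k), ?_, fun g => ?_⟩
  · rw [← hn]
    refine (pi_norm_le_iff_of_nonneg (norm_nonneg ψ)).2 fun k => ?_
    rw [LinearIsometryEquiv.norm_map]
    exact hχ k
  · have h1 : (g : PiLp 1 fun _ : ι => E) = ∑ k, J k ((g : PiLp 1 fun _ : ι => E) k) := by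
      ext i
      simp [J, Finset.sum_apply, Pi.single_apply]
    rw [← hψ g]
    conv_lhs => rw [h1, map_sum]
    refine Finset.sum_congr rfl fun k _ => ?_
    rw [real_inner_comm, InnerProductSpace.toDual_symm_apply]
    rfl

/-- A family of functionals that is close to a family of inner products with its data `T P` has
a common zero, provided that it is small at the origin. -/
theorem exists_common_zero {W : Type*} [AddCommGroup W] [Module ℝ W]
    (T : W →ₗ[ℝ] (ι → E)) (Φ : (ι → E) → W →ₗ[ℝ] ℝ) {ρ : ℝ} (hρ : 0 < ρ)
    (hb : ∀ P v v', ‖v‖ ≤ ρ → ‖v'‖ ≤ ρ →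
      |Φ v P - Φ v' P - ∑ k, ⟪T P k, v k - v' k⟫_ℝ| ≤ 1 / 2 * ‖v - v'‖ * ∑ k, ‖T P k‖)
    (hc : ∀ P, |Φ 0 P| ≤ ρ / 2 * ∑ k, ‖T P k‖) :
    ∃ v : ι → E, ‖v‖ ≤ ρ ∧ ∀ P, Φ v P = 0 := by
  let T' : W →ₗ[ℝ] PiLp 1 fun _ : ι => E := (WithLp.linearEquiv 1 ℝ (ι → E)).symm.toLinearMap ∘ₗ T
  have hT' : ∀ P k, T' P k = T P k := fun P k => rfl
  have hnT : ∀ P, ‖T' P‖ = ∑ k, ‖T P k‖ := fun P => PiLp.norm_eq_of_L1 _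
  let V := LinearMap.range T'
  obtain ⟨s, hs⟩ := T'.rangeRestrict.exists_rightInverse_of_surjective
    (LinearMap.range_eq_top.2 T'.surjective_rangeRestrict)
  have hs' : ∀ g : V, T' (s g) = g := fun g => by
    have := LinearMap.congr_fun hs g
    exact congrArg Subtype.val this
  have hsn : ∀ g : V, ∑ k, ‖T (s g) k‖ = ‖g‖ := fun g => by rw [← hnT, hs']; rfl
  let F : (ι → E) → StrongDual ℝ V := fun v => LinearMap.toContinuousLinearMap (Φ v ∘ₗ s)
  let L₀ : (ι → E) →ₗ[ℝ] StrongDual ℝ V :=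
    { toFun := fun v => LinearMap.toContinuousLinearMap
        { toFun := fun g => ∑ k, ⟪(g : PiLp 1 fun _ : ι => E) k, v k⟫_ℝ
          map_add' := fun g h => by simp [inner_add_left, Finset.sum_add_distrib]
          map_smul' := fun a g => by simp [inner_smul_left, Finset.mul_sum] }
      map_add' := fun u v => by
        ext g
        simp [inner_add_right, Finset.sum_add_distrib]
      map_smul' := fun a u => by
        ext g
        simp [inner_smul_right, Finset.mul_sum] }
  let L : (ι → E) →L[ℝ] StrongDual ℝ V := LinearMap.toContinuousLinearMap L₀
  have hL : ∀ v (g : V), L v g = ∑ k, ⟪(g : PiLp 1 fun _ : ι => E) k, v k⟫_ℝ := fun _ _ => rfl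
  choose R hR1 hR2 using exists_pi_norm_le_of_dual (ι := ι) (E := E) V
  have hLR : ∀ φ, L (R φ) = φ := fun φ => by
    ext g
    rw [hR2 φ g]
    exact hL (R φ) g
  have hF : ∀ v v', ‖v‖ ≤ ρ → ‖v'‖ ≤ ρ → ‖F v - F v' - L (v - v')‖ ≤ 1 / 2 * ‖v - v'‖ := by
    intro v v' hv hv'
    refine ContinuousLinearMap.opNorm_le_bound _ (by positivity) fun g => ?_
    have h1 := hb (s g) v v' hv hv'
    have h2 : (F v - F v' - L (v - v')) g =
        Φ v (s g) - Φ v' (s g) - ∑ k, ⟪T (s g) k, v k - v' k⟫_ℝ := by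
      have h3 : L (v - v') g = ∑ k, ⟪T (s g) k, v k - v' k⟫_ℝ := by
        rw [hL, ← hs' g]
        rfl
      rw [← h3]
      rfl
    rw [h2, Real.norm_eq_abs]
    rwa [hsn] at h1
  have h0 : ‖F 0‖ ≤ ρ / 2 := by
    refine ContinuousLinearMap.opNorm_le_bound _ (by positivity) fun g => ?_
    have := hc (s g)
    rwa [hsn] at this
  obtain ⟨v, hv, hv0⟩ := exists_zero_of_approximates L R hR1 hLR hρ hF h0
  refine ⟨v, hv, fun P => ?_⟩
  set P' := s (T'.rangeRestrict P) with hP'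
  have h1 : Φ v P' = 0 := by
    have := congrArg (fun φ : StrongDual ℝ V => φ (T'.rangeRestrict P)) hv0
    exact this
  have h2 : T (P - P') = 0 := by
    have h3 : T' (P - P') = 0 := by
      rw [map_sub, hP', hs']
      exact sub_self _
    funext k
    rw [← hT', h3]; rfl
  have h4 : Φ 0 (P - P') = 0 := by
    have := hc (P - P')
    simpa [h2] using this
  have h5 : Φ v (P - P') = 0 := by
    have := hb (P - P') v 0 hv (by simpa using hρ.le)
    simpa [h2, h4] using this
  rw [map_sub, h1, sub_zero] at h5
  exact h5

end Newton

theorem pEval_add (P Q : MvPolynomial (Fin d) ℝ) (x : EuclideanSpace ℝ (Fin d)) :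
    pEval (P + Q) x = pEval P x + pEval Q x := map_add _ _ _

theorem pEval_smul (a : ℝ) (P : MvPolynomial (Fin d) ℝ) (x : EuclideanSpace ℝ (Fin d)) :
    pEval (a • P) x = a * pEval P x := MvPolynomial.smul_eval _ _ _

theorem polyGrad_add (P Q : MvPolynomial (Fin d) ℝ) (x : EuclideanSpace ℝ (Fin d)) :
    polyGrad (P + Q) x = polyGrad P x + polyGrad Q x := by
  ext i
  simp [polyGrad]

theorem polyGrad_smul (a : ℝ) (P : MvPolynomial (Fin d) ℝ) (x : EuclideanSpace ℝ (Fin d)) :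
    polyGrad (a • P) x = a • polyGrad P x := by
  ext i
  simp [polyGrad]

theorem tGrad_add (P Q : MvPolynomial (Fin d) ℝ) (x : EuclideanSpace ℝ (Fin d)) :
    tGrad (P + Q) x = tGrad P x + tGrad Q x := by
  simp only [tGrad, polyGrad_add, inner_add_right]
  module

theorem tGrad_smul (a : ℝ) (P : MvPolynomial (Fin d) ℝ) (x : EuclideanSpace ℝ (Fin d)) :
    tGrad (a • P) x = a • tGrad P x := by
  simp only [tGrad, polyGrad_smul, inner_smul_right]
  module

/-- The Marcinkiewicz–Zygmund property for tangential gradients of polynomials of degree at most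
`n`, at points `y j` with weights `c j`. -/
def GradMZ (A n : ℕ) (C : ℝ) {J : Type*} [Fintype J] (c : J → ℝ)
    (y : J → EuclideanSpace ℝ (Fin d)) : Prop :=
  ∀ P : MvPolynomial (Fin d) ℝ, P.totalDegree ≤ n → ∃ M : J → ℝ,
    (∀ j, LocBound A n (tGrad P) (y j) (M j)) ∧ ∑ j, c j * M j ≤ C * ∑ j, c j * ‖tGrad P (y j)‖

/-- A cubature rule that is close to the functional `I` may be corrected by moving its nodes. -/
theorem exists_correction {ι J : Type*} [Fintype ι] [Fintype J] (κ : J → ι)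
    {y : ι → EuclideanSpace ℝ (Fin d)} (hy : ∀ k, ‖y k‖ = 1) {c : J → ℝ} (hc : ∀ j, 0 ≤ c j)
    {u : J → EuclideanSpace ℝ (Fin d)} {ρ : ℝ} (hu : ∀ j, ‖u j‖ ≤ ρ) {n A : ℕ} (hn : 0 < n)
    {C : ℝ} (hMZ : GradMZ A n C c fun j => y (κ j)) (hρ : 0 < ρ)
    (hnρ : n * (2 * ρ) ≤ 1 / 4) (hC : gradConst A * n * (2 * ρ) * C ≤ 1 / 2)
    (I : MvPolynomial (Fin d) ℝ →ₗ[ℝ] ℝ)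
    (hI : ∀ P : MvPolynomial (Fin d) ℝ, P.totalDegree ≤ n →
      |∑ j, c j * radial P (y (κ j) + u j) - I P| ≤ ρ / 2 * ∑ j, c j * ‖tGrad P (y (κ j))‖) :
    ∃ v : ι → EuclideanSpace ℝ (Fin d), (∀ k, ‖v k‖ ≤ ρ) ∧
      ∀ P : MvPolynomial (Fin d) ℝ, P.totalDegree ≤ n →
        ∑ j, c j * radial P (y (κ j) + (u j + v (κ j))) = I P := by
  classical
  let m : ι → ℝ := fun k => ∑ j with κ j = k, c j
  have hm : ∀ k, 0 ≤ m k := fun k => Finset.sum_nonneg fun j _ => hc j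
  have hmf : ∀ f : ι → ℝ, ∑ k, m k * f k = ∑ j, c j * f (κ j) := by
    intro f
    rw [← Finset.sum_fiberwise (s := Finset.univ) (g := κ)]
    refine Finset.sum_congr rfl fun k _ => ?_
    rw [Finset.sum_mul]
    refine Finset.sum_congr rfl fun j hj => ?_
    rw [(Finset.mem_filter.1 hj).2]
  let W := MvPolynomial.restrictTotalDegree (Fin d) ℝ n
  have hW : ∀ P : W, (P : MvPolynomial (Fin d) ℝ).totalDegree ≤ n := fun P =>
    (MvPolynomial.mem_restrictTotalDegree _ _ _).1 P.2
  let T : W →ₗ[ℝ] (ι → EuclideanSpace ℝ (Fin d)) :=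
    { toFun := fun P k => m k • tGrad (P : MvPolynomial (Fin d) ℝ) (y k)
      map_add' := fun P Q => by
        funext k
        simp [tGrad_add]
      map_smul' := fun a P => by
        funext k
        simp [tGrad_smul, smul_comm a] }
  let Φ : (ι → EuclideanSpace ℝ (Fin d)) → W →ₗ[ℝ] ℝ := fun v =>
    { toFun := fun P => ∑ j, c j * radial (P : MvPolynomial (Fin d) ℝ)
        (y (κ j) + (u j + v (κ j))) - I P
      map_add' := fun P Q => by
        simp only [Submodule.coe_add, radial, pEval_add, mul_add, Finset.sum_add_distrib, map_add]
        ring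
      map_smul' := fun a P => by
        simp only [Submodule.coe_smul, radial, pEval_smul, map_smul, smul_eq_mul,
          RingHom.id_apply, mul_sub, Finset.mul_sum]
        congr 1
        exact Finset.sum_congr rfl fun j _ => by ring }
  have hTn : ∀ P : W, ∑ k, ‖T P k‖ = ∑ j, c j * ‖tGrad (P : MvPolynomial (Fin d) ℝ) (y (κ j))‖ := by
    intro P
    rw [← hmf fun k => ‖tGrad (P : MvPolynomial (Fin d) ℝ) (y k)‖]
    refine Finset.sum_congr rfl fun k _ => ?_
    simp [T, norm_smul, abs_of_nonneg (hm k)]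
  have hb : ∀ P v v', ‖v‖ ≤ ρ → ‖v'‖ ≤ ρ →
      |Φ v P - Φ v' P - ∑ k, ⟪T P k, v k - v' k⟫_ℝ| ≤ 1 / 2 * ‖v - v'‖ * ∑ k, ‖T P k‖ := by
    intro P v v' hv hv'
    obtain ⟨M, hM, hMs⟩ := hMZ P (hW P)
    have h1 : ∑ k, ⟪T P k, v k - v' k⟫_ℝ = ∑ j, c j *
        ⟪tGrad (P : MvPolynomial (Fin d) ℝ) (y (κ j)), v (κ j) - v' (κ j)⟫_ℝ := by
      rw [← hmf fun k => ⟪tGrad (P : MvPolynomial (Fin d) ℝ) (y k), v k - v' k⟫_ℝ]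
      refine Finset.sum_congr rfl fun k _ => ?_
      simp [T, inner_smul_left]
    have h2 : Φ v P - Φ v' P - ∑ k, ⟪T P k, v k - v' k⟫_ℝ = ∑ j, c j *
        (radial P (y (κ j) + (u j + v (κ j))) - radial P (y (κ j) + (u j + v' (κ j))) -
        ⟪tGrad (P : MvPolynomial (Fin d) ℝ) (y (κ j)), v (κ j) - v' (κ j)⟫_ℝ) := by
      rw [h1]
      simp only [Φ, LinearMap.coe_mk, AddHom.coe_mk, mul_sub, Finset.sum_sub_distrib]
      ring
    have hle : ∀ (w : ι → EuclideanSpace ℝ (Fin d)), ‖w‖ ≤ ρ → ∀ j,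
        ‖u j + w (κ j)‖ ≤ 2 * ρ := fun w hw j => by
      have := norm_add_le (u j) (w (κ j))
      have := (norm_le_pi_norm w (κ j)).trans hw
      linarith [hu j]
    have hS : 0 ≤ ∑ j, c j * ‖tGrad (P : MvPolynomial (Fin d) ℝ) (y (κ j))‖ :=
      Finset.sum_nonneg fun j _ => mul_nonneg (hc j) (norm_nonneg _)
    have hG := one_le_gradConst A
    rw [h2, hTn]
    calc _ ≤ ∑ j, c j * (gradConst A * n * (2 * ρ) * M j * ‖v - v'‖) := by
          refine (Finset.abs_sum_le_sum_abs _ _).trans (Finset.sum_le_sum fun j _ => ?_)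
          rw [abs_mul, abs_of_nonneg (hc j)]
          refine mul_le_mul_of_nonneg_left ?_ (hc j)
          have h3 := abs_radial_sub_sub_le hn (hW P) (hy (κ j)) (hM j) hnρ (hle v hv j)
            (hle v' hv' j)
          have h4 : u j + v (κ j) - (u j + v' (κ j)) = v (κ j) - v' (κ j) := by abel
          rw [h4] at h3
          refine h3.trans (mul_le_mul_of_nonneg_left (norm_le_pi_norm (v - v') (κ j)) ?_)
          have := (hM j).nonneg (hy (κ j))
          positivity
      _ = gradConst A * n * (2 * ρ) * ‖v - v'‖ * ∑ j, c j * M j := by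
          rw [Finset.mul_sum]
          exact Finset.sum_congr rfl fun j _ => by ring
      _ ≤ gradConst A * n * (2 * ρ) * ‖v - v'‖ *
          (C * ∑ j, c j * ‖tGrad (P : MvPolynomial (Fin d) ℝ) (y (κ j))‖) :=
          mul_le_mul_of_nonneg_left hMs (by positivity)
      _ = (gradConst A * n * (2 * ρ) * C) * ‖v - v'‖ *
          ∑ j, c j * ‖tGrad (P : MvPolynomial (Fin d) ℝ) (y (κ j))‖ := by ring
      _ ≤ _ := mul_le_mul_of_nonneg_right (mul_le_mul_of_nonneg_right hC (norm_nonneg _)) hS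
  have h0 : ∀ P, |Φ 0 P| ≤ ρ / 2 * ∑ k, ‖T P k‖ := by
    intro P
    rw [hTn]
    simpa [Φ] using hI P (hW P)
  obtain ⟨v, hv, hv0⟩ := exists_common_zero T Φ hρ hb h0
  refine ⟨v, fun k => (norm_le_pi_norm v k).trans hv, fun P hP => ?_⟩
  exact sub_eq_zero.1 (hv0 ⟨P, (MvPolynomial.mem_restrictTotalDegree _ _ _).2 hP⟩)

theorem continuous_tGrad (P : MvPolynomial (Fin d) ℝ) : Continuous (tGrad P) := by
  have h : Continuous (polyGrad P) :=
    (EuclideanSpace.equiv (Fin d) ℝ).symm.continuous.comp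
      (continuous_pi fun i => continuous_pEval (MvPolynomial.pderiv i P))
  have h1 : Continuous fun x => ⟪x, polyGrad P x⟫_ℝ := continuous_id.inner h
  exact h.sub (h1.smul continuous_id)

/-- The best constant in `LocBound` is attained. -/
theorem exists_locBound_eq (A n : ℕ) {F : Type*} [SeminormedAddCommGroup F]
    {f : EuclideanSpace ℝ (Fin d) → F} (hf : Continuous f) {x : EuclideanSpace ℝ (Fin d)}
    (hx : ‖x‖ = 1) :
    ∃ M y, ‖y‖ = 1 ∧ LocBound A n f x M ∧ M * (1 + n * ‖x - y‖) ^ A = ‖f y‖ := by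
  have hpos : ∀ y, 0 < (1 + n * ‖x - y‖) ^ A := fun y => by positivity
  have hc : Continuous fun y => ‖f y‖ / (1 + n * ‖x - y‖) ^ A :=
    hf.norm.div (by fun_prop) fun y => (hpos y).ne'
  obtain ⟨y, hy, hmax⟩ := (isCompact_sphere (0 : EuclideanSpace ℝ (Fin d)) 1).exists_isMaxOn
    ⟨x, by simpa using hx⟩ hc.continuousOn
  refine ⟨‖f y‖ / (1 + n * ‖x - y‖) ^ A, y, by simpa using hy, fun z hz => ?_, ?_⟩
  · exact (div_le_iff₀ (hpos z)).1 (hmax (show z ∈ Metric.sphere 0 1 by simpa using hz))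
  · exact div_mul_cancel₀ _ (ne_of_gt (hpos y))

/-- Dyadic decomposition of the kernel `(1 + t) ^ (-A)`. -/
theorem inv_one_add_pow_le_sum {t : ℝ} (ht : 0 ≤ t) (A : ℕ) {m : ℕ} (hm : t ≤ 2 ^ m) :
    ((1 + t) ^ A)⁻¹ ≤ ∑ i ∈ Finset.range (m + 1), 2 ^ A * ((2 ^ A)⁻¹) ^ i *
      (if t ≤ 2 ^ i then 1 else 0) := by
  classical
  have hex : ∃ i : ℕ, t ≤ 2 ^ i := ⟨m, hm⟩
  set i := Nat.find hex with hi
  have hti : t ≤ 2 ^ i := Nat.find_spec hex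
  have him : i ∈ Finset.range (m + 1) := Finset.mem_range.2 (Nat.lt_succ_of_le (Nat.find_min' hex hm))
  have h1 : ((1 + t) ^ A)⁻¹ ≤ 2 ^ A * ((2 ^ A)⁻¹ : ℝ) ^ i * (if t ≤ 2 ^ i then 1 else 0) := by
    rw [if_pos hti, mul_one]
    rcases Nat.eq_zero_or_pos i with h0 | h0
    · rw [h0, pow_zero, mul_one]
      exact (inv_le_one_of_one_le₀ (one_le_pow₀ (by linarith))).trans
        (one_le_pow₀ (by norm_num))
    · obtain ⟨j, hj⟩ := Nat.exists_eq_succ_of_ne_zero h0.ne'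
      have h2 : ¬ t ≤ 2 ^ j := Nat.find_min hex (by omega)
      rw [hj, pow_succ, mul_comm, mul_assoc, inv_mul_cancel₀ (by positivity), mul_one,
        inv_pow]
      refine inv_anti₀ (by positivity) ?_
      rw [← pow_mul, mul_comm, pow_mul]
      exact pow_le_pow_left₀ (by positivity) (by linarith) _
  refine h1.trans (Finset.single_le_sum (f := fun i => 2 ^ A * ((2 ^ A)⁻¹ : ℝ) ^ i *
      (if t ≤ 2 ^ i then 1 else 0)) (fun k _ => ?_) him)
  split_ifs <;> positivity

/-- Local mass estimates for the weights `a` at the nodes `ξ`, relative to the set function `β` on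
balls. -/
structure MassCompare (β : EuclideanSpace ℝ (Fin d) → ℝ → ℝ) (D : ℝ) : Prop where
  pos : ∀ x, ‖x‖ = 1 → ∀ r, 0 < r → 0 < β x r
  mono : ∀ x y r t, r + ‖x - y‖ ≤ t → β x r ≤ β y t
  doubling : ∀ x, ‖x‖ = 1 → ∀ r, 0 < r → β x (2 * r) ≤ D * β x r

namespace MassCompare

variable {β : EuclideanSpace ℝ (Fin d) → ℝ → ℝ} {D : ℝ}

theorem doubling_pow (hβ : MassCompare β D) (hD : 0 ≤ D) {x : EuclideanSpace ℝ (Fin d)}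
    (hx : ‖x‖ = 1) {r : ℝ} (hr : 0 < r) (i : ℕ) : β x (2 ^ i * r) ≤ D ^ i * β x r := by
  induction i with
  | zero => simp
  | succ i ih =>
    have h1 := hβ.doubling x hx (2 ^ i * r) (by positivity)
    have h2 : (2 : ℝ) ^ (i + 1) * r = 2 * (2 ^ i * r) := by ring
    rw [h2, pow_succ, mul_comm (D ^ i) D, mul_assoc]
    exact h1.trans (mul_le_mul_of_nonneg_left ih hD)

theorem sum_kernel_le (hβ : MassCompare β D) (hD : 0 ≤ D) {n A : ℕ} (hn : 0 < n)
    (hA : 2 * D ≤ 2 ^ A) {ι : Type*} [Fintype ι] {a : ι → ℝ} (ha : ∀ k, 0 ≤ a k)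
    {ξ : ι → EuclideanSpace ℝ (Fin d)} (hξ : ∀ k, ‖ξ k‖ = 1) {c₁ : ℝ} (hc₁ : 0 ≤ c₁)
    (hup : ∀ y, ‖y‖ = 1 → ∀ r, 1 / (n : ℝ) ≤ r →
      ∑ k, a k * (if ‖ξ k - y‖ ≤ r then 1 else 0) ≤ c₁ * β y r)
    {y : EuclideanSpace ℝ (Fin d)} (hy : ‖y‖ = 1) :
    ∑ k, a k * ((1 + n * ‖ξ k - y‖) ^ A)⁻¹ ≤ 2 * 2 ^ A * c₁ * β y (1 / (n : ℝ)) := by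
  have hn' : (0 : ℝ) < n := by exact_mod_cast hn
  obtain ⟨m, hm⟩ := pow_unbounded_of_one_lt (2 * n : ℝ) one_lt_two
  have hb := (hβ.pos y hy (1 / (n : ℝ)) (by positivity)).le
  have hξm : ∀ k, n * ‖ξ k - y‖ ≤ 2 ^ m := fun k => by
    have h1 := norm_sub_le (ξ k) y
    rw [hξ, hy] at h1
    nlinarith
  calc _ ≤ ∑ k, a k * ∑ i ∈ Finset.range (m + 1), 2 ^ A * ((2 ^ A : ℝ)⁻¹) ^ i *
        (if n * ‖ξ k - y‖ ≤ 2 ^ i then 1 else 0) :=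
        Finset.sum_le_sum fun k _ => mul_le_mul_of_nonneg_left
          (inv_one_add_pow_le_sum (by positivity) A (hξm k)) (ha k)
    _ = ∑ i ∈ Finset.range (m + 1), 2 ^ A * ((2 ^ A : ℝ)⁻¹) ^ i *
        ∑ k, a k * (if ‖ξ k - y‖ ≤ 2 ^ i * (1 / (n : ℝ)) then 1 else 0) := by
        simp only [Finset.mul_sum]
        rw [Finset.sum_comm]
        refine Finset.sum_congr rfl fun i _ => Finset.sum_congr rfl fun k _ => ?_
        have h1 : n * ‖ξ k - y‖ ≤ 2 ^ i ↔ ‖ξ k - y‖ ≤ 2 ^ i * (1 / (n : ℝ)) := by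
          rw [mul_one_div, le_div_iff₀ hn', mul_comm]
        rw [if_congr h1 rfl rfl]
        ring
    _ ≤ ∑ i ∈ Finset.range (m + 1), 2 ^ A * c₁ * β y (1 / (n : ℝ)) * (1 / 2) ^ i := by
        refine Finset.sum_le_sum fun i _ => ?_
        have h1 := hup y hy (2 ^ i * (1 / (n : ℝ)))
          (le_mul_of_one_le_left (by positivity) (one_le_pow₀ one_le_two))
        have h2 := h1.trans (mul_le_mul_of_nonneg_left
          (hβ.doubling_pow hD hy (show 0 < 1 / (n : ℝ) by positivity) i) hc₁)
        refine (mul_le_mul_of_nonneg_left h2 (by positivity)).trans ?_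
        have h3 : ((2 ^ A : ℝ)⁻¹) ^ i * D ^ i ≤ (1 / 2) ^ i := by
          rw [← mul_pow]
          refine pow_le_pow_left₀ (by positivity) ?_ _
          rw [inv_mul_le_iff₀ (by positivity)]
          linarith
        calc _ = 2 ^ A * c₁ * β y (1 / (n : ℝ)) * (((2 ^ A : ℝ)⁻¹) ^ i * D ^ i) := by ring
          _ ≤ _ := mul_le_mul_of_nonneg_left h3 (by positivity)
    _ = 2 ^ A * c₁ * β y (1 / (n : ℝ)) * ∑ i ∈ Finset.range (m + 1), (1 / 2) ^ i := by
        rw [Finset.mul_sum]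
    _ ≤ 2 ^ A * c₁ * β y (1 / (n : ℝ)) * 2 :=
        mul_le_mul_of_nonneg_left (sum_geometric_two_le _) (by positivity)
    _ = _ := by ring

/-- A Marcinkiewicz–Zygmund inequality for tangential gradients. -/
theorem gradMZ (hβ : MassCompare β D) (hD : 0 ≤ D) {n A : ℕ} (hn : 0 < n)
    (hA : 2 * D ≤ 2 ^ A) {ι : Type*} [Fintype ι] {a : ι → ℝ} (ha : ∀ k, 0 ≤ a k)
    {ξ : ι → EuclideanSpace ℝ (Fin d)} (hξ : ∀ k, ‖ξ k‖ = 1) {c₁ c₂ η : ℝ} (hc₁ : 0 ≤ c₁)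
    (hc₂ : 0 < c₂) (hη : η ≤ 1 / 2) (hη' : 2 * (bernsteinConst A * 2 ^ A) * η ≤ 1 / 2)
    (hup : ∀ y, ‖y‖ = 1 → ∀ r, 1 / (n : ℝ) ≤ r →
      ∑ k, a k * (if ‖ξ k - y‖ ≤ r then 1 else 0) ≤ c₁ * β y r)
    (hlow : ∀ y, ‖y‖ = 1 →
      c₂ * β y (1 / (n : ℝ)) ≤ ∑ k, a k * (if ‖ξ k - y‖ ≤ η / n then 1 else 0)) :
    GradMZ A n (2 * D / c₂ * 2 ^ A * (2 * 2 ^ A * c₁)) a ξ := by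
  have hn' : (1 : ℝ) ≤ n := by exact_mod_cast hn
  have hn0 : (0 : ℝ) < n := by linarith
  have hB := one_le_bernsteinConst A
  intro P hP
  have hf := continuous_tGrad P
  choose M y hy hM hMy using fun k => exists_locBound_eq A n hf (hξ k)
  refine ⟨M, hM, ?_⟩
  have hβ0 : ∀ x, ‖x‖ = 1 → 0 < β x (1 / (n : ℝ)) := fun x hx => hβ.pos x hx _ (by positivity)
  have hM0 : ∀ k, 0 ≤ M k := fun k => (hM k).nonneg (hξ k)
  have hkey : ∀ k l, ‖ξ l - y k‖ ≤ η / n → ‖tGrad P (y k)‖ ≤ 2 * ‖tGrad P (ξ l)‖ := by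
    intro k l hl
    have h1 : LocBound A n (tGrad P) (y k) ‖tGrad P (y k)‖ := by
      have := (hM k).translate (hξ k) (y := y k)
      rwa [hMy] at this
    rw [norm_sub_rev, le_div_iff₀ hn0, mul_comm] at hl
    have h2 := norm_tGrad_sub_le hn hP (hy k) (hξ l) (hl.trans hη) h1
    have h3 : 2 * (bernsteinConst A * n * (2 ^ A * ‖tGrad P (y k)‖)) * ‖y k - ξ l‖ =
        ‖tGrad P (y k)‖ * (2 * (bernsteinConst A * 2 ^ A) * (n * ‖y k - ξ l‖)) := by ring
    have h4 : 2 * (bernsteinConst A * 2 ^ A) * (n * ‖y k - ξ l‖) ≤ 1 / 2 :=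
      (mul_le_mul_of_nonneg_left hl (by positivity)).trans hη'
    have h5 := mul_le_mul_of_nonneg_left h4 (norm_nonneg (tGrad P (y k)))
    have h6 := norm_sub_norm_le (tGrad P (y k)) (tGrad P (ξ l))
    linarith
  have hMk : ∀ k, M k ≤ 2 * D / c₂ * 2 ^ A * ∑ l, a l * ‖tGrad P (ξ l)‖ / β (ξ l) (1 / (n : ℝ)) *
      ((1 + n * ‖ξ k - ξ l‖) ^ A)⁻¹ := by
    intro k
    have hp : 0 < (1 + n * ‖ξ k - y k‖) ^ A := by positivity
    have h1 : c₂ * M k ≤ ∑ l, 2 * D * 2 ^ A * (a l * ‖tGrad P (ξ l)‖ / β (ξ l) (1 / (n : ℝ)) *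
        ((1 + n * ‖ξ k - ξ l‖) ^ A)⁻¹) := by
      have h2 := mul_le_mul_of_nonneg_right (hlow (y k) (hy k))
        (show 0 ≤ M k / β (y k) (1 / (n : ℝ)) from div_nonneg (hM0 k) (hβ0 _ (hy k)).le)
      have h3 : c₂ * β (y k) (1 / (n : ℝ)) * (M k / β (y k) (1 / (n : ℝ))) = c₂ * M k := by
        have := (hβ0 _ (hy k)).ne'
        field_simp
      rw [h3, Finset.sum_mul] at h2
      refine h2.trans (Finset.sum_le_sum fun l _ => ?_)
      by_cases hl : ‖ξ l - y k‖ ≤ η / n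
      · rw [if_pos hl, mul_one]
        have h4 := hkey k l hl
        have hl1 : ‖ξ l - y k‖ ≤ 1 / n := hl.trans (by gcongr; linarith)
        have hl2 : n * ‖ξ l - y k‖ ≤ 1 := by
          rwa [le_div_iff₀ hn0, mul_comm] at hl1
        have h5 : β (ξ l) (1 / (n : ℝ)) ≤ D * β (y k) (1 / (n : ℝ)) :=
          (hβ.mono (ξ l) (y k) (1 / (n : ℝ)) (2 * (1 / (n : ℝ))) (by linarith)).trans
            (hβ.doubling _ (hy k) _ (by positivity))
        have h6 : (1 + n * ‖ξ k - ξ l‖) ^ A ≤ 2 ^ A * (1 + n * ‖ξ k - y k‖) ^ A := by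
          rw [← mul_pow]
          refine pow_le_pow_left₀ (by positivity) ?_ _
          have : ‖ξ k - ξ l‖ ≤ ‖ξ k - y k‖ + ‖ξ l - y k‖ := by
            rw [norm_sub_rev (ξ l)]
            simpa using norm_add_le (ξ k - y k) (y k - ξ l)
          have := mul_le_mul_of_nonneg_left this hn0.le
          have : 0 ≤ n * ‖ξ k - y k‖ := by positivity
          linarith
        have hq : 0 < (1 + n * ‖ξ k - ξ l‖) ^ A := by positivity
        have hbl := hβ0 _ (hξ l)
        have hby := hβ0 _ (hy k)
        have e1 : 2 * D * 2 ^ A * (a l * ‖tGrad P (ξ l)‖ / β (ξ l) (1 / (n : ℝ)) *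
            ((1 + n * ‖ξ k - ξ l‖) ^ A)⁻¹) = a l * ((2 * ‖tGrad P (ξ l)‖) *
            (D / β (ξ l) (1 / (n : ℝ))) * (2 ^ A / (1 + n * ‖ξ k - ξ l‖) ^ A)) := by
          field_simp
        have e2 : M k = ‖tGrad P (y k)‖ / (1 + n * ‖ξ k - y k‖) ^ A := by
          rw [← hMy k, mul_div_cancel_right₀ _ hp.ne']
        have e3 : M k / β (y k) (1 / (n : ℝ)) = ‖tGrad P (y k)‖ * (1 / β (y k) (1 / (n : ℝ))) *
            (1 / (1 + n * ‖ξ k - y k‖) ^ A) := by rw [e2]; field_simp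
        rw [e1, e3]
        refine mul_le_mul_of_nonneg_left ?_ (ha l)
        have h7 : 1 / β (y k) (1 / (n : ℝ)) ≤ D / β (ξ l) (1 / (n : ℝ)) := by
          rw [div_le_div_iff₀ hby hbl, one_mul]; exact h5
        have h8 : 1 / (1 + n * ‖ξ k - y k‖) ^ A ≤ 2 ^ A / (1 + n * ‖ξ k - ξ l‖) ^ A := by
          rw [div_le_div_iff₀ hp hq, one_mul]; exact h6
        gcongr
      · rw [if_neg hl, mul_zero, zero_mul]
        have := (hβ0 _ (hξ l)).le
        have := ha l
        positivity
    rw [← Finset.mul_sum] at h1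
    have h9 : 2 * D / c₂ * 2 ^ A * ∑ l, a l * ‖tGrad P (ξ l)‖ / β (ξ l) (1 / (n : ℝ)) *
      ((1 + n * ‖ξ k - ξ l‖) ^ A)⁻¹ = (2 * D * 2 ^ A * ∑ l, a l * ‖tGrad P (ξ l)‖ /
      β (ξ l) (1 / (n : ℝ)) * ((1 + n * ‖ξ k - ξ l‖) ^ A)⁻¹) / c₂ := by ring
    rw [h9, le_div_iff₀ hc₂, mul_comm]
    exact h1
  calc ∑ k, a k * M k ≤ ∑ k, a k * (2 * D / c₂ * 2 ^ A * ∑ l, a l * ‖tGrad P (ξ l)‖ /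
        β (ξ l) (1 / (n : ℝ)) * ((1 + n * ‖ξ k - ξ l‖) ^ A)⁻¹) :=
        Finset.sum_le_sum fun k _ => mul_le_mul_of_nonneg_left (hMk k) (ha k)
    _ = 2 * D / c₂ * 2 ^ A * ∑ l, a l * ‖tGrad P (ξ l)‖ / β (ξ l) (1 / (n : ℝ)) *
        ∑ k, a k * ((1 + n * ‖ξ k - ξ l‖) ^ A)⁻¹ := by
        simp only [Finset.mul_sum]
        rw [Finset.sum_comm]
        exact Finset.sum_congr rfl fun l _ => Finset.sum_congr rfl fun k _ => by ring
    _ ≤ 2 * D / c₂ * 2 ^ A * ∑ l, a l * ‖tGrad P (ξ l)‖ / β (ξ l) (1 / (n : ℝ)) *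
        (2 * 2 ^ A * c₁ * β (ξ l) (1 / (n : ℝ))) := by
        refine mul_le_mul_of_nonneg_left (Finset.sum_le_sum fun l _ =>
          mul_le_mul_of_nonneg_left (hβ.sum_kernel_le hD hn hA ha hξ hc₁ hup (hξ l)) ?_)
          (by positivity)
        have := (hβ0 _ (hξ l)).le
        have := ha l
        positivity
    _ = _ := by
        rw [mul_assoc (2 * D / c₂ * 2 ^ A), Finset.mul_sum (a := 2 * 2 ^ A * c₁)]
        congr 1
        refine Finset.sum_congr rfl fun l _ => ?_
        have := (hβ0 _ (hξ l)).ne'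
        field_simp

end MassCompare

/-- The Marcinkiewicz–Zygmund property is stable under small perturbations of the nodes. -/
theorem GradMZ.perturb {A n : ℕ} (hn : 0 < n) {C : ℝ} (hC : 0 ≤ C) {J : Type*} [Fintype J]
    {c : J → ℝ} (hc : ∀ j, 0 ≤ c j) {y z : J → EuclideanSpace ℝ (Fin d)} (h : GradMZ A n C c y)
    (hy : ∀ j, ‖y j‖ = 1) (hz : ∀ j, ‖z j‖ = 1) {r : ℝ} (hyz : ∀ j, ‖y j - z j‖ ≤ r)
    (hr : n * r ≤ 1 / 2) (hr' : C * (2 * (bernsteinConst A * 2 ^ A) * (n * r)) ≤ 1 / 2) :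
    GradMZ A n (2 * (2 ^ A * C)) c z := by
  intro P hP
  obtain ⟨M, hM, hs⟩ := h P hP
  have hB := one_le_bernsteinConst A
  have hnr : ∀ j, n * ‖y j - z j‖ ≤ 1 / 2 := fun j =>
    (mul_le_mul_of_nonneg_left (hyz j) (Nat.cast_nonneg n)).trans hr
  refine ⟨fun j => 2 ^ A * M j, fun j => (hM j).near (hy j) ((hnr j).trans (by norm_num)), ?_⟩
  have hM0 : ∀ j, 0 ≤ M j := fun j => (hM j).nonneg (hy j)
  have h1 : ∀ j, ‖tGrad P (y j)‖ ≤ ‖tGrad P (z j)‖ +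
      2 * (bernsteinConst A * 2 ^ A) * (n * r) * M j := fun j => by
    have h2 := norm_tGrad_sub_le hn hP (hy j) (hz j) (hnr j) (hM j)
    have h3 := norm_sub_norm_le (tGrad P (y j)) (tGrad P (z j))
    have h4 : 2 * (bernsteinConst A * n * (2 ^ A * M j)) * ‖y j - z j‖ ≤
        2 * (bernsteinConst A * n * (2 ^ A * M j)) * r :=
      mul_le_mul_of_nonneg_left (hyz j) (by have := hM0 j; positivity)
    linarith
  have h5 : ∑ j, c j * ‖tGrad P (y j)‖ ≤ ∑ j, c j * ‖tGrad P (z j)‖ +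
      2 * (bernsteinConst A * 2 ^ A) * (n * r) * ∑ j, c j * M j := by
    rw [Finset.mul_sum, ← Finset.sum_add_distrib]
    refine Finset.sum_le_sum fun j _ => ?_
    have := mul_le_mul_of_nonneg_left (h1 j) (hc j)
    linarith
  set X := ∑ j, c j * ‖tGrad P (y j)‖ with hX
  set Y := ∑ j, c j * ‖tGrad P (z j)‖ with hY
  have hX0 : 0 ≤ X := Finset.sum_nonneg fun j _ => mul_nonneg (hc j) (norm_nonneg _)
  rcases isEmpty_or_nonempty J with hJ | ⟨⟨j₀⟩⟩
  · simp [hY]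
  have hr0 : 0 ≤ r := (norm_nonneg _).trans (hyz j₀)
  have h6 : 2 * (bernsteinConst A * 2 ^ A) * (n * r) * ∑ j, c j * M j ≤ 1 / 2 * X := by
    calc _ ≤ 2 * (bernsteinConst A * 2 ^ A) * (n * r) * (C * X) :=
          mul_le_mul_of_nonneg_left hs (by positivity)
      _ = C * (2 * (bernsteinConst A * 2 ^ A) * (n * r)) * X := by ring
      _ ≤ _ := mul_le_mul_of_nonneg_right hr' hX0
  have h7 : X ≤ 2 * Y := by linarith
  calc ∑ j, c j * (2 ^ A * M j) = 2 ^ A * ∑ j, c j * M j := by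
        rw [Finset.mul_sum]; exact Finset.sum_congr rfl fun j _ => by ring
    _ ≤ 2 ^ A * (C * X) := mul_le_mul_of_nonneg_left hs (by positivity)
    _ ≤ 2 ^ A * (C * (2 * Y)) := by gcongr
    _ = _ := by ring

theorem one_lt_rank_euclideanSpace (hd : 2 ≤ d) :
    1 < Module.rank ℝ (EuclideanSpace ℝ (Fin d)) := by
  rw [rank_eq_card_basis (EuclideanSpace.basisFun (Fin d) ℝ).toBasis, Fintype.card_fin]
  exact_mod_cast hd

/-- The first `m` terms of `ξ` form an `s`-separated chain of points of the sphere, in which every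
point but the first is within `2s` of an earlier one, its parent. -/
structure IsNetTree (s : ℝ) (m : ℕ) (ξ : ℕ → EuclideanSpace ℝ (Fin d)) (p : ℕ → ℕ) : Prop where
  norm_eq : ∀ k < m, ‖ξ k‖ = 1
  sep : ∀ k < m, ∀ l < m, k ≠ l → s < ‖ξ k - ξ l‖
  parent_lt : ∀ k < m, 1 ≤ k → p k < k
  parent_near : ∀ k < m, 1 ≤ k → ‖ξ k - ξ (p k)‖ ≤ 2 * s

theorem IsNetTree.exists_card_le {s : ℝ} (hs : 0 < s) :
    ∃ B : ℕ, ∀ m (ξ : ℕ → EuclideanSpace ℝ (Fin d)) p, IsNetTree s m ξ p → m ≤ B := by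
  obtain ⟨t, -, htf, ht⟩ := (isCompact_sphere (0 : EuclideanSpace ℝ (Fin d)) 1).finite_cover_balls
    (half_pos hs)
  refine ⟨htf.toFinset.card, fun m ξ p h => ?_⟩
  have h1 : ∀ k : Fin m, ∃ c ∈ t, ‖ξ k - c‖ < s / 2 := fun k => by
    have := ht (show ξ k ∈ Metric.sphere 0 1 by simpa using h.norm_eq k k.2)
    simpa [dist_eq_norm] using this
  choose c hc hcs using h1
  have hinj : Function.Injective c := by
    intro k l hkl
    by_contra hne
    have h2 := h.sep k k.2 l l.2 (fun h => hne (Fin.ext h))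
    have h3 := norm_sub_le (ξ k - c k) (ξ l - c k)
    have h4 := hcs k
    have h5 := hcs l
    rw [← hkl] at h5
    rw [sub_sub_sub_cancel_right] at h3
    linarith
  have := Finset.card_le_card_of_injOn c (s := Finset.univ) (t := htf.toFinset)
    (fun k _ => by simpa using hc k) hinj.injOn
  simpa using this

theorem IsNetTree.extend (hd : 2 ≤ d) {s : ℝ} (hs : 0 < s) {m : ℕ} (hm : 0 < m)
    {ξ : ℕ → EuclideanSpace ℝ (Fin d)} {p : ℕ → ℕ} (h : IsNetTree s m ξ p)
    {x : EuclideanSpace ℝ (Fin d)} (hx : ‖x‖ = 1) (hxs : ∀ k < m, s < ‖x - ξ k‖) :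
    ∃ ξ' : ℕ → EuclideanSpace ℝ (Fin d), ∃ p', IsNetTree s (m + 1) ξ' p' := by
  set K : Set (EuclideanSpace ℝ (Fin d)) := ξ '' Iio m with hK
  have hKf : K.Finite := (finite_Iio m).image ξ
  have hKn : K.Nonempty := ⟨ξ 0, 0, hm, rfl⟩
  have hpre := isPreconnected_sphere (one_lt_rank_euclideanSpace hd)
    (0 : EuclideanSpace ℝ (Fin d)) 1
  have hatt : ∀ z, ∃ k < m, Metric.infDist z K = ‖z - ξ k‖ := fun z => by
    obtain ⟨_, ⟨k, hk, rfl⟩, h1⟩ := hKf.isCompact.exists_infDist_eq_dist hKn z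
    exact ⟨k, hk, by rw [h1, dist_eq_norm]⟩
  have hxK : s < Metric.infDist x K := by
    obtain ⟨k, hk, h1⟩ := hatt x
    rw [h1]
    exact hxs k hk
  have h0 : Metric.infDist (ξ 0) K = 0 := Metric.infDist_zero_of_mem ⟨0, hm, rfl⟩
  obtain ⟨z, hz, hzd⟩ := hpre.intermediate_value
    (show ξ 0 ∈ Metric.sphere (0 : EuclideanSpace ℝ (Fin d)) 1 by simpa using h.norm_eq 0 hm)
    (show x ∈ Metric.sphere (0 : EuclideanSpace ℝ (Fin d)) 1 by simpa using hx)
    (f := fun z => Metric.infDist z K) (Metric.continuous_infDist_pt K).continuousOn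
    (show min (Metric.infDist x K) (2 * s) ∈ _ from
      ⟨by rw [h0]; exact le_min (by linarith) (by linarith), min_le_left _ _⟩)
  have hz1 : ‖z‖ = 1 := by simpa using hz
  dsimp only at hzd
  have hzs : s < Metric.infDist z K := by rw [hzd]; exact lt_min hxK (by linarith)
  have hz2 : Metric.infDist z K ≤ 2 * s := by rw [hzd]; exact min_le_right _ _
  have hzk : ∀ k < m, s < ‖z - ξ k‖ := fun k hk => hzs.trans_le (by
    rw [← dist_eq_norm]
    exact Metric.infDist_le_dist_of_mem ⟨k, hk, rfl⟩)
  obtain ⟨q, hq, hqd⟩ := hatt z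
  have hξ : ∀ k < m, Function.update ξ m z k = ξ k := fun k hk =>
    Function.update_of_ne hk.ne _ _
  have hp : ∀ k < m, Function.update p m q k = p k := fun k hk =>
    Function.update_of_ne hk.ne _ _
  refine ⟨Function.update ξ m z, Function.update p m q, ?_, ?_, ?_, ?_⟩
  · intro k hk
    rcases Nat.lt_succ_iff_lt_or_eq.1 hk with hk | rfl
    · rw [hξ k hk]; exact h.norm_eq k hk
    · simpa using hz1
  · intro k hk l hl hkl
    rcases Nat.lt_succ_iff_lt_or_eq.1 hk with hk | rfl <;>
      rcases Nat.lt_succ_iff_lt_or_eq.1 hl with hl | rfl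
    · rw [hξ k hk, hξ l hl]; exact h.sep k hk l hl hkl
    · rw [hξ k hk, Function.update_self, norm_sub_rev]; exact hzk k hk
    · rw [hξ l hl, Function.update_self]; exact hzk l hl
    · exact absurd rfl hkl
  · intro k hk h1
    rcases Nat.lt_succ_iff_lt_or_eq.1 hk with hk | rfl
    · rw [hp k hk]; exact h.parent_lt k hk h1
    · simpa using hq
  · intro k hk h1
    rcases Nat.lt_succ_iff_lt_or_eq.1 hk with hk | rfl
    · rw [hp k hk, hξ k hk, hξ _ ((h.parent_lt k hk h1).trans hk)]
      exact h.parent_near k hk h1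
    · rw [Function.update_self, Function.update_self, hξ q hq, ← hqd]
      exact hz2

theorem exists_netTree (hd : 2 ≤ d) {s : ℝ} (hs : 0 < s) :
    ∃ m, ∃ ξ : ℕ → EuclideanSpace ℝ (Fin d), ∃ p, IsNetTree s m ξ p ∧
      ∀ x, ‖x‖ = 1 → ∃ k < m, ‖x - ξ k‖ ≤ s := by
  classical
  obtain ⟨B, hB⟩ := IsNetTree.exists_card_le (d := d) hs
  let Q : ℕ → Prop := fun m => ∃ ξ : ℕ → EuclideanSpace ℝ (Fin d), ∃ p, IsNetTree s m ξ p
  have hQ1 : Q 1 := by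
    refine ⟨fun _ => EuclideanSpace.single ⟨0, by omega⟩ 1, fun _ => 0, ?_, ?_, ?_, ?_⟩
    · intro k _; simp
    · intro k hk l hl hkl; omega
    · intro k hk h1; omega
    · intro k hk h1; omega
  have h1B : 1 ≤ B := by
    obtain ⟨ξ, p, h⟩ := hQ1
    exact hB 1 ξ p h
  set m := Nat.findGreatest Q B with hm
  have hm1 : 1 ≤ m := Nat.le_findGreatest h1B hQ1
  obtain ⟨ξ, p, h⟩ : Q m := Nat.findGreatest_spec h1B hQ1
  refine ⟨m, ξ, p, h, fun x hx => ?_⟩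
  by_contra hcon
  push Not at hcon
  obtain ⟨ξ', p', h'⟩ := h.extend hd hs hm1 hx hcon
  have := Nat.le_findGreatest (P := Q) (hB _ _ _ h') ⟨ξ', p', h'⟩
  omega

/-- Real masses with integral total, placed at the vertices of a tree, may be rounded to integers
by moving a mass less than one from every vertex to its parent. -/
theorem exists_tree_rounding (p : ℕ → ℕ) (m : ℕ) (b : ℕ → ℝ)
    (hp : ∀ k < m, 1 ≤ k → p k < k) (hb : ∃ z : ℤ, ∑ k ∈ Finset.range m, b k = z) :
    ∃ t : ℕ → ℝ, (∀ k, 0 ≤ t k ∧ t k < 1) ∧ t 0 = 0 ∧ ∀ k < m, ∃ z : ℤ,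
      b k + (∑ c ∈ Finset.range m, if p c = k then t c else 0) - t k = z := by
  induction m generalizing b with
  | zero => exact ⟨0, fun _ => by simp, rfl, fun k hk => by omega⟩
  | succ m ih =>
    rcases Nat.eq_zero_or_pos m with rfl | hm
    · refine ⟨0, fun _ => by simp, rfl, fun k hk => ?_⟩
      have : k = 0 := by omega
      subst this
      simpa using hb
    · obtain ⟨z, hz⟩ := hb
      have hpm := hp m (Nat.lt_succ_self m) hm
      obtain ⟨t, ht, ht0, htk⟩ := ih (fun k => b k + if p m = k then Int.fract (b m) else 0)
        (fun k hk => hp k (by omega)) ⟨z - ⌊b m⌋, by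
          rw [Finset.sum_add_distrib, Finset.sum_ite_eq, if_pos (Finset.mem_range.2 hpm)]
          rw [Finset.sum_range_succ] at hz
          push_cast
          rw [← hz, ← Int.self_sub_floor]
          ring⟩
      have htm : ∀ k < m, Function.update t m (Int.fract (b m)) k = t k := fun k hk =>
        Function.update_of_ne hk.ne _ _
      have hsum : ∀ k, (∑ c ∈ Finset.range m,
          if p c = k then Function.update t m (Int.fract (b m)) c else 0) =
          ∑ c ∈ Finset.range m, if p c = k then t c else 0 := fun k =>
        Finset.sum_congr rfl fun c hc => by rw [htm c (Finset.mem_range.1 hc)]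
      refine ⟨Function.update t m (Int.fract (b m)), fun k => ?_, ?_, fun k hk => ?_⟩
      · by_cases h : k = m
        · subst h
          rw [Function.update_self]
          exact ⟨Int.fract_nonneg _, Int.fract_lt_one _⟩
        · rw [Function.update_of_ne h]; exact ht k
      · rw [htm 0 hm, ht0]
      · rw [Finset.sum_range_succ, Function.update_self, hsum]
        rcases Nat.lt_succ_iff_lt_or_eq.1 hk with hk | rfl
        · obtain ⟨z', hz'⟩ := htk k hk
          refine ⟨z', ?_⟩
          rw [htm k hk, ← hz']
          ring
        · refine ⟨⌊b k⌋, ?_⟩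
          rw [if_neg hpm.ne, Function.update_self, Finset.sum_eq_zero, ← Int.self_sub_fract]
          · ring
          · intro c hc
            have hc := Finset.mem_range.1 hc
            rcases Nat.eq_zero_or_pos c with rfl | h0
            · rw [ht0, ite_self]
            · exact if_neg fun h => by
                have := hp c (by omega) h0
                omega

theorem exists_netPartition {m : ℕ} {s : ℝ} (hs : 0 < s) {ξ : ℕ → EuclideanSpace ℝ (Fin d)}
    (hsep : ∀ k < m, ∀ l < m, k ≠ l → s < ‖ξ k - ξ l‖)
    (hcov : ∀ x, ‖x‖ = 1 → ∃ k < m, ‖x - ξ k‖ ≤ s) :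
    ∃ I : ℕ → Set (EuclideanSpace ℝ (Fin d)), (∀ k, MeasurableSet (I k)) ∧
      Pairwise (Function.onFun Disjoint I) ∧ (∀ k < m, Metric.closedBall (ξ k) (s / 3) ⊆ I k) ∧
      (∀ k, I k ⊆ Metric.closedBall (ξ k) s) ∧ ∀ x, ‖x‖ = 1 → ∃ k < m, x ∈ I k := by
  let U : ℕ → Set (EuclideanSpace ℝ (Fin d)) := fun k => {x | k < m ∧ ‖x - ξ k‖ ≤ s ∧
    ∀ l < m, l ≠ k → s / 3 < ‖x - ξ l‖}
  have hU : ∀ k, MeasurableSet (U k) := by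
    intro k
    refine (MeasurableSet.const _).inter (MeasurableSet.inter ?_ ?_)
    · exact (isClosed_le (f := fun x => ‖x - ξ k‖) (by fun_prop) continuous_const).measurableSet
    · have : {x : EuclideanSpace ℝ (Fin d) | ∀ l < m, l ≠ k → s / 3 < ‖x - ξ l‖} =
          ⋂ l, ⋂ (_ : l < m), ⋂ (_ : l ≠ k), {x | s / 3 < ‖x - ξ l‖} := by ext; simp
      rw [show (fun a : EuclideanSpace ℝ (Fin d) => ∀ l < m, l ≠ k → s / 3 < ‖a - ξ l‖) =
        {x : EuclideanSpace ℝ (Fin d) | ∀ l < m, l ≠ k → s / 3 < ‖x - ξ l‖} from rfl, this]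
      exact MeasurableSet.iInter fun l => MeasurableSet.iInter fun _ => MeasurableSet.iInter fun _ =>
        (isOpen_lt continuous_const (by fun_prop)).measurableSet
  have hball : ∀ k < m, Metric.closedBall (ξ k) (s / 3) ⊆ disjointed U k := by
    intro k hk x hx
    rw [Metric.mem_closedBall, dist_eq_norm] at hx
    have h1 : x ∈ U k := by
      refine ⟨hk, by linarith, fun l hl hlk => ?_⟩
      have h2 := hsep k hk l hl hlk.symm
      have h3 := norm_sub_le_norm_sub_add_norm_sub (ξ k) x (ξ l)
      rw [norm_sub_rev (ξ k) x] at h3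
      linarith
    rw [disjointed_eq_inter_compl]
    refine ⟨h1, mem_iInter₂.2 fun l hl hlU => ?_⟩
    have := hlU.2.2 k hk (ne_of_gt hl)
    linarith
  refine ⟨disjointed U, fun k => MeasurableSet.disjointed hU k, disjoint_disjointed U, hball,
    fun k x hx => ?_, fun x hx => ?_⟩
  · have := disjointed_subset U k hx
    rw [Metric.mem_closedBall, dist_eq_norm]
    exact this.2.1
  · by_cases h : ∃ k < m, ‖x - ξ k‖ ≤ s / 3
    · obtain ⟨k, hk, h⟩ := h
      exact ⟨k, hk, hball k hk (by rwa [Metric.mem_closedBall, dist_eq_norm])⟩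
    · push Not at h
      obtain ⟨k, hk, hxk⟩ := hcov x hx
      have h1 : x ∈ ⋃ l, disjointed U l := by
        rw [iUnion_disjointed]
        exact mem_iUnion.2 ⟨k, hk, hxk, fun l hl _ => h l hl⟩
      obtain ⟨l, hl⟩ := mem_iUnion.1 h1
      exact ⟨l, (disjointed_subset U l hl).1, hl⟩

theorem integrable_pEval {μ : Measure (EuclideanSpace ℝ (Fin d))} [IsFiniteMeasure μ]
    (hμ : ∀ᵐ x ∂μ, ‖x‖ = 1) (P : MvPolynomial (Fin d) ℝ) : Integrable (pEval P) μ := by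
  obtain ⟨C, hC⟩ := (isCompact_sphere (0 : EuclideanSpace ℝ (Fin d)) 1).exists_bound_of_continuousOn
    (continuous_pEval P).continuousOn
  refine Integrable.of_bound (continuous_pEval P).aestronglyMeasurable C ?_
  filter_upwards [hμ] with x hx
  exact hC x (by simpa using hx)

/-- Integer masses at the points of a net that imitate the measure `N μ`. -/
theorem exists_discretization (hd : 2 ≤ d) {μ : Measure (EuclideanSpace ℝ (Fin d))}
    [IsProbabilityMeasure μ] (hμ : ∀ᵐ x ∂μ, ‖x‖ = 1) {N : ℕ} {s : ℝ} (hs : 0 < s)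
    (hN : ∀ x, ‖x‖ = 1 → 2 ≤ N * μ.real (Metric.closedBall x (s / 3))) :
    ∃ m : ℕ, ∃ ξ : Fin m → EuclideanSpace ℝ (Fin d), ∃ a : Fin m → ℕ, (∀ k, ‖ξ k‖ = 1) ∧
      ∑ k, a k = N ∧
      (∀ y r, ∑ k, (a k : ℝ) * (if ‖ξ k - y‖ ≤ r then 1 else 0) ≤
        2 * (N * μ.real (Metric.closedBall y (r + 3 * s)))) ∧
      (∀ y r, N * μ.real (Metric.closedBall y (r - s)) / 2 ≤
        ∑ k, (a k : ℝ) * (if ‖ξ k - y‖ ≤ r then 1 else 0)) ∧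
      ∀ (A n : ℕ) (P : MvPolynomial (Fin d) ℝ) (M : Fin m → ℝ), 0 < n → n * (2 * s) ≤ 1 / 4 →
        (∀ k, LocBound A n (tGrad P) (ξ k) (M k)) →
        |∑ k, (a k : ℝ) * pEval P (ξ k) - N * ∫ x, pEval P x ∂μ| ≤
          4 * gradConst A * s * ∑ k, a k * M k := by
  classical
  obtain ⟨m, ξ, p, hξ, hcov⟩ := exists_netTree hd hs
  obtain ⟨I, hIm, hId, hIb, hIs, hIc⟩ := exists_netPartition hs hξ.sep hcov
  set b : ℕ → ℝ := fun k => N * μ.real (I k) with hb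
  have hb0 : ∀ k, 0 ≤ b k := fun k => by positivity
  have hb2 : ∀ k < m, 2 ≤ b k := fun k hk =>
    (hN _ (hξ.norm_eq k hk)).trans (mul_le_mul_of_nonneg_left
      (measureReal_mono (hIb k hk)) (Nat.cast_nonneg N))
  have hsumT : ∀ T : Finset ℕ, ∑ k ∈ T, b k = N * μ.real (⋃ k ∈ T, I k) := fun T => by
    rw [measureReal_biUnion_finset (fun k _ l _ hkl => hId hkl) (fun k _ => hIm k),
      Finset.mul_sum]
  have hsub : ∀ (T : Finset ℕ) S, (∀ k ∈ T, I k ⊆ S) → ∑ k ∈ T, b k ≤ N * μ.real S :=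
    fun T S h => by
      rw [hsumT]
      exact mul_le_mul_of_nonneg_left (measureReal_mono (iUnion₂_subset h)) (Nat.cast_nonneg N)
  have hae : ∀ᵐ x ∂μ, x ∈ ⋃ k ∈ Finset.range m, I k := by
    filter_upwards [hμ] with x hx
    obtain ⟨k, hk, h⟩ := hIc x hx
    exact mem_biUnion (Finset.mem_coe.2 (Finset.mem_range.2 hk)) h
  have hae' : (⋃ k ∈ Finset.range m, I k) =ᵐ[μ] univ := Filter.eventuallyEq_univ.2 hae
  have hbN : ∑ k ∈ Finset.range m, b k = N := by
    rw [hsumT, measureReal_congr hae', probReal_univ, mul_one]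
  obtain ⟨t, ht, ht0, htz⟩ := exists_tree_rounding p m b hξ.parent_lt ⟨N, by simpa using hbN⟩
  set e : ℕ → ℝ := fun k => b k + (∑ c ∈ Finset.range m, if p c = k then t c else 0) - t k with he
  have heb : ∀ k < m, b k / 2 ≤ e k := fun k hk => by
    have h1 := hb2 k hk
    have h2 := (ht k).2
    have h3 : 0 ≤ ∑ c ∈ Finset.range m, if p c = k then t c else 0 :=
      Finset.sum_nonneg fun c _ => by split_ifs; exacts [(ht c).1, le_rfl]
    simp only [he]
    linarith
  have hnat : ∀ k : Fin m, ∃ a : ℕ, e k = a := fun k => by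
    obtain ⟨z, hz⟩ := htz k k.2
    have h1 := heb k k.2
    have h2 := hb0 k
    have h3 : (0 : ℝ) ≤ z := by rw [← hz]; simp only [he] at h1; linarith
    have h4 : 0 ≤ z := by exact_mod_cast h3
    refine ⟨z.toNat, ?_⟩
    have h5 : ((z.toNat : ℤ) : ℝ) = z := by rw [Int.toNat_of_nonneg h4]
    simp only [he]
    rw [hz, ← h5, Int.cast_natCast]
  choose a ha using hnat
  have hpar : ∀ c < m, t c ≠ 0 → 1 ≤ c ∧ p c < m := fun c hc h => by
    have h1 : 1 ≤ c := Nat.one_le_iff_ne_zero.2 fun h0 => h (h0 ▸ ht0)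
    exact ⟨h1, (hξ.parent_lt c hc h1).trans hc⟩
  have htr : ∀ f : ℕ → ℝ, ∑ k ∈ Finset.range m, e k * f k =
      ∑ k ∈ Finset.range m, b k * f k + ∑ c ∈ Finset.range m, t c * (f (p c) - f c) := by
    intro f
    have h1 : ∑ k ∈ Finset.range m, (∑ c ∈ Finset.range m, if p c = k then t c else 0) * f k =
        ∑ c ∈ Finset.range m, t c * f (p c) := by
      simp_rw [Finset.sum_mul]
      rw [Finset.sum_comm]
      refine Finset.sum_congr rfl fun c hc => ?_
      simp_rw [ite_mul, zero_mul]
      rw [Finset.sum_ite_eq]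
      by_cases h : t c = 0
      · simp [h]
      · rw [if_pos (Finset.mem_range.2 (hpar c (Finset.mem_range.1 hc) h).2)]
    simp only [he, sub_mul, add_mul, mul_sub, Finset.sum_add_distrib, Finset.sum_sub_distrib, h1]
    ring
  have hfin : ∀ f : ℕ → ℝ, ∑ k : Fin m, (a k : ℝ) * f k = ∑ k ∈ Finset.range m, e k * f k :=
    fun f => by
      rw [← Fin.sum_univ_eq_sum_range (fun k => e k * f k)]
      exact Finset.sum_congr rfl fun k _ => by rw [ha]
  refine ⟨m, fun k => ξ k, a, fun k => hξ.norm_eq k k.2, ?_, fun y r => ?_, fun y r => ?_, ?_⟩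
  · have h1 := hfin fun _ => 1
    rw [htr] at h1
    simp only [mul_one, sub_self, mul_zero, Finset.sum_const_zero, add_zero, hbN] at h1
    exact_mod_cast h1
  · rw [hfin fun k => if ‖ξ k - y‖ ≤ r then 1 else 0, htr]
    have h1 : ∑ k ∈ Finset.range m, b k * (if ‖ξ k - y‖ ≤ r then 1 else 0) ≤
        N * μ.real (Metric.closedBall y (r + 3 * s)) := by
      simp_rw [mul_ite, mul_one, mul_zero]
      rw [← Finset.sum_filter]
      refine hsub _ _ fun k hk x hx => ?_
      have h2 := (Finset.mem_filter.1 hk).2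
      have h3 := hIs k hx
      rw [Metric.mem_closedBall, dist_eq_norm] at h3 ⊢
      linarith [norm_sub_le_norm_sub_add_norm_sub x (ξ k) y]
    have h2 : ∑ c ∈ Finset.range m, t c * ((if ‖ξ (p c) - y‖ ≤ r then 1 else 0) -
        (if ‖ξ c - y‖ ≤ r then 1 else 0)) ≤ N * μ.real (Metric.closedBall y (r + 3 * s)) := by
      refine (Finset.sum_le_sum (g := fun c => if 1 ≤ c ∧ ‖ξ (p c) - y‖ ≤ r then b c else 0)
        fun c hc => ?_).trans ?_
      · have hc := Finset.mem_range.1 hc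
        have h3 := hb2 c hc
        obtain ⟨h4, h5⟩ := ht c
        by_cases h0 : t c = 0
        · rw [h0, zero_mul]
          split_ifs <;> linarith
        · have h6 := (hpar c hc h0).1
          split_ifs <;> first | linarith | (exfalso; tauto)
      · rw [← Finset.sum_filter]
        refine hsub _ _ fun k hk x hx => ?_
        obtain ⟨h3, h4, h5⟩ := Finset.mem_filter.1 hk
        have h6 := hξ.parent_near k (Finset.mem_range.1 h3) h4
        have h7 := hIs k hx
        rw [Metric.mem_closedBall, dist_eq_norm] at h7 ⊢
        linarith [norm_sub_le_norm_sub_add_norm_sub x (ξ k) y,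
          norm_sub_le_norm_sub_add_norm_sub (ξ k) (ξ (p k)) y]
    linarith
  · rw [hfin fun k => if ‖ξ k - y‖ ≤ r then 1 else 0]
    have h1 : N * μ.real (Metric.closedBall y (r - s)) ≤
        ∑ k ∈ Finset.range m with ‖ξ k - y‖ ≤ r, b k := by
      rw [hsumT]
      refine mul_le_mul_of_nonneg_left ?_ (Nat.cast_nonneg N)
      refine ENNReal.toReal_mono (measure_ne_top _ _) (measure_mono_ae ?_)
      filter_upwards [hμ] with x hx hxy
      obtain ⟨k, hk, h⟩ := hIc x hx
      refine mem_biUnion (Finset.mem_coe.2 (Finset.mem_filter.2 ⟨Finset.mem_range.2 hk, ?_⟩)) h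
      have h3 := hIs k h
      have h4 : x ∈ Metric.closedBall y (r - s) := hxy
      rw [Metric.mem_closedBall, dist_eq_norm] at h3 h4
      have := norm_sub_le_norm_sub_add_norm_sub (ξ k) x y
      rw [norm_sub_rev (ξ k) x] at this
      linarith
    refine (div_le_div_of_nonneg_right h1 (by norm_num)).trans ?_
    simp_rw [mul_ite, mul_one, mul_zero]
    rw [← Finset.sum_filter, Finset.sum_div]
    exact Finset.sum_le_sum fun k hk => heb k (Finset.mem_range.1 (Finset.mem_filter.1 hk).1)
  · intro A n P M hn hns hM
    have hG := one_le_gradConst A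
    set M' : ℕ → ℝ := fun k => if h : k < m then M ⟨k, h⟩ else 0 with hM'
    have hMM : ∀ k : Fin m, M k = M' k := fun k => by simp [hM']
    have hL : ∀ k < m, LocBound A n (tGrad P) (ξ k) (M' k) := fun k hk => by
      simpa [hM', hk] using hM ⟨k, hk⟩
    have hM0 : ∀ k < m, 0 ≤ M' k := fun k hk => (hL k hk).nonneg (hξ.norm_eq k hk)
    have hPi := integrable_pEval hμ P
    have hloc : ∀ k < m, ∀ x, ‖x‖ = 1 → ∀ r, ‖x - ξ k‖ ≤ r → n * r ≤ 1 / 4 →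
        |pEval P x - pEval P (ξ k)| ≤ gradConst A * M' k * r := by
      intro k hk x hx r hr hnr
      have h1 := abs_radial_sub_le_of_locBound hn (hξ.norm_eq k hk) (hL k hk) hnr
        (v := x - ξ k) (v' := 0) hr (by simpa using (norm_nonneg _).trans hr)
      rw [add_sub_cancel, add_zero, radial_of_norm_eq_one P hx,
        radial_of_norm_eq_one P (hξ.norm_eq k hk), sub_zero] at h1
      exact h1.trans (mul_le_mul_of_nonneg_left hr (mul_nonneg (by linarith) (hM0 k hk)))
    have hint : N * ∫ x, pEval P x ∂μ =
        ∑ k ∈ Finset.range m, N * ∫ x in I k, pEval P x ∂μ := by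
      rw [← Finset.mul_sum, ← integral_biUnion_finset _ (fun k _ => hIm k)
        (fun k _ l _ hkl => hId hkl) (fun k _ => hPi.integrableOn), setIntegral_congr_set hae',
        setIntegral_univ]
    have hcell : ∀ k < m, |b k * pEval P (ξ k) - N * ∫ x in I k, pEval P x ∂μ| ≤
        b k * (gradConst A * M' k * s) := by
      intro k hk
      have h1 : b k * pEval P (ξ k) - N * ∫ x in I k, pEval P x ∂μ =
          N * ∫ x in I k, (pEval P (ξ k) - pEval P x) ∂μ := by
        rw [integral_sub (integrable_const _) hPi.integrableOn, setIntegral_const, smul_eq_mul]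
        ring
      rw [h1, abs_mul, Nat.abs_cast, hb, mul_assoc]
      refine mul_le_mul_of_nonneg_left ?_ (Nat.cast_nonneg N)
      rw [mul_comm (μ.real _), ← Real.norm_eq_abs]
      refine norm_setIntegral_le_of_norm_le_const_ae' (measure_lt_top _ _) ?_
      filter_upwards [hμ] with x hx hxk
      rw [Real.norm_eq_abs, abs_sub_comm]
      refine hloc k hk x hx s ?_ ?_
      · have := hIs k hxk
        rwa [Metric.mem_closedBall, dist_eq_norm] at this
      · have : (0 : ℝ) ≤ n * s := by positivity
        linarith
    have hmove : ∀ c < m, |t c * (pEval P (ξ (p c)) - pEval P (ξ c))| ≤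
        t c * (gradConst A * M' c * (2 * s)) := by
      intro c hc
      rw [abs_mul, abs_of_nonneg (ht c).1]
      by_cases h : t c = 0
      · simp [h]
      · obtain ⟨h1, h2⟩ := hpar c hc h
        refine mul_le_mul_of_nonneg_left (hloc c hc _ (hξ.norm_eq _ h2) _ ?_ hns) (ht c).1
        rw [norm_sub_rev]
        exact hξ.parent_near c hc h1
    rw [hfin fun k => pEval P (ξ k), htr, hint, add_sub_right_comm, ← Finset.sum_sub_distrib]
    simp_rw [hMM]
    rw [hfin M']
    calc _ ≤ ∑ k ∈ Finset.range m, b k * (gradConst A * M' k * s) +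
          ∑ c ∈ Finset.range m, t c * (gradConst A * M' c * (2 * s)) :=
        (abs_add_le _ _).trans (add_le_add
          ((Finset.abs_sum_le_sum_abs _ _).trans (Finset.sum_le_sum fun k hk =>
            hcell k (Finset.mem_range.1 hk)))
          ((Finset.abs_sum_le_sum_abs _ _).trans (Finset.sum_le_sum fun k hk =>
            hmove k (Finset.mem_range.1 hk))))
      _ = ∑ k ∈ Finset.range m, (b k + 2 * t k) * (gradConst A * M' k * s) := by
        rw [← Finset.sum_add_distrib]
        exact Finset.sum_congr rfl fun k _ => by ring
      _ ≤ ∑ k ∈ Finset.range m, (4 * e k) * (gradConst A * M' k * s) := by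
        refine Finset.sum_le_sum fun k hk => ?_
        have hk := Finset.mem_range.1 hk
        have h1 := heb k hk
        have h2 := hb2 k hk
        have h3 := ht k
        have h4 := hM0 k hk
        exact mul_le_mul_of_nonneg_right (by linarith) (by positivity)
      _ = _ := by
        rw [Finset.mul_sum]
        exact Finset.sum_congr rfl fun k _ => by ring

theorem eventually_mul_le (c : ℝ) {δ : ℝ} (hδ : 0 < δ) :
    ∀ᶠ ρ in nhdsWithin (0 : ℝ) (Ioi 0), c * ρ ≤ δ := by
  have h : Filter.Tendsto (fun ρ : ℝ => c * ρ) (nhdsWithin 0 (Ioi 0)) (nhds 0) := by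
    have h1 : Continuous fun ρ : ℝ => c * ρ := by fun_prop
    simpa using (h1.tendsto 0).mono_left nhdsWithin_le_nhds
  exact h.eventually_le_const hδ

theorem exists_unit_orthogonal (hd : 2 ≤ d) (y : EuclideanSpace ℝ (Fin d)) :
    ∃ e : EuclideanSpace ℝ (Fin d), ‖e‖ = 1 ∧ ⟪y, e⟫_ℝ = 0 := by
  have h : (innerSL ℝ y).toLinearMap.ker ≠ ⊥ := by
    refine LinearMap.ker_ne_bot_of_finrank_lt ?_
    rw [finrank_euclideanSpace_fin, Module.finrank_self]
    omega
  obtain ⟨e, he, h0⟩ := Submodule.exists_mem_ne_zero_of_ne_bot h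
  refine ⟨‖e‖⁻¹ • e, norm_inv_norm_smul h0, ?_⟩
  have h1 : ⟪y, e⟫_ℝ = 0 := he
  rw [inner_smul_right, h1, mul_zero]

/-- Multiple nodes of an equal-weight rule may be pulled apart. -/
theorem exists_distinct_nodes (hd : 2 ≤ d) {m N A n : ℕ} (hn : 0 < n)
    {z : Fin m → EuclideanSpace ℝ (Fin d)} (hz : ∀ k, ‖z k‖ = 1) {a : Fin m → ℕ}
    (ha : ∑ k, a k = N) {C : ℝ} (hMZ : GradMZ A n C (fun k => (a k : ℝ)) z)
    (I : MvPolynomial (Fin d) ℝ →ₗ[ℝ] ℝ)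
    (hI : ∀ P : MvPolynomial (Fin d) ℝ, P.totalDegree ≤ n →
      ∑ k, (a k : ℝ) * pEval P (z k) = I P) :
    ∃ Z : Finset (EuclideanSpace ℝ (Fin d)), Z.card = N ∧ (∀ x ∈ Z, ‖x‖ = 1) ∧
      ∀ P : MvPolynomial (Fin d) ℝ, P.totalDegree ≤ n → ∑ x ∈ Z, pEval P x = I P := by
  classical
  have hG := one_le_gradConst A
  let J := Σ k : Fin m, Fin (a k)
  have hJ : Fintype.card J = N := by simp [J, Fintype.card_sigma, ha]
  have hsum : ∀ f : Fin m → ℝ, ∑ j : J, f j.1 = ∑ k, (a k : ℝ) * f k := fun f => by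
    rw [Fintype.sum_sigma]
    simp
  let idx := Fintype.equivFinOfCardEq hJ
  let κ : J → range z := fun j => ⟨z j.1, j.1, rfl⟩
  have hy : ∀ k : range z, ‖(k : EuclideanSpace ℝ (Fin d))‖ = 1 := by
    rintro ⟨_, k, rfl⟩
    exact hz k
  choose e he1 he using fun k : range z => exists_unit_orthogonal hd (k : EuclideanSpace ℝ (Fin d))
  have hMZ' : GradMZ A n C (fun _ : J => (1 : ℝ))
      fun j => (κ j : EuclideanSpace ℝ (Fin d)) := by
    intro P hP
    obtain ⟨M, hM, hs⟩ := hMZ P hP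
    refine ⟨fun j => M j.1, fun j => hM j.1, ?_⟩
    simp_rw [one_mul]
    rw [hsum, hsum fun k => ‖tGrad P (z k)‖]
    exact hs
  obtain ⟨ρ, hρ, hρ1, hρ2, hρ3⟩ : ∃ ρ : ℝ, 0 < ρ ∧ n * (2 * ρ) ≤ 1 / 4 ∧
      gradConst A * n * (2 * ρ) * C ≤ 1 / 2 ∧
      ∀ k l : range z, k ≠ l → 16 * ρ ≤ ‖(k : EuclideanSpace ℝ (Fin d)) - l‖ := by
    have h1 := eventually_mul_le (n * 2) (by norm_num : (0 : ℝ) < 1 / 4)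
    have h2 := eventually_mul_le (gradConst A * n * 2 * C) (by norm_num : (0 : ℝ) < 1 / 2)
    have h3 : ∀ᶠ ρ in nhdsWithin (0 : ℝ) (Ioi 0), ∀ k l : range z, k ≠ l →
        16 * ρ ≤ ‖(k : EuclideanSpace ℝ (Fin d)) - l‖ := by
      refine Filter.eventually_all.2 fun k => Filter.eventually_all.2 fun l => ?_
      by_cases h : k = l
      · exact Filter.Eventually.of_forall fun _ h' => absurd h h'
      · filter_upwards [eventually_mul_le 16
          (norm_pos_iff.2 (sub_ne_zero.2 (Subtype.coe_ne_coe.2 h)))] with ρ hρ _ using hρ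
    obtain ⟨ρ, h1, h2, h3, h0⟩ := (h1.and (h2.and (h3.and self_mem_nhdsWithin))).exists
    exact ⟨ρ, h0, by linarith, by linarith, h3⟩
  obtain ⟨τ, hτ, hτ1, hτ2⟩ : ∃ τ : ℝ, 0 < τ ∧ τ * N ≤ ρ ∧
      gradConst A * (τ * N) * C ≤ ρ / 2 := by
    have h1 := eventually_mul_le N hρ
    have h2 := eventually_mul_le (gradConst A * N * C) (half_pos hρ)
    obtain ⟨τ, h1, h2, h0⟩ := (h1.and (h2.and self_mem_nhdsWithin)).exists
    exact ⟨τ, h0, by linarith, by linarith⟩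
  let u : J → EuclideanSpace ℝ (Fin d) := fun j => (τ * (idx j : ℕ)) • e (κ j)
  have hu' : ∀ j, ‖u j‖ ≤ τ * N := fun j => by
    rw [norm_smul, he1, mul_one, Real.norm_of_nonneg (by positivity)]
    exact mul_le_mul_of_nonneg_left (by exact_mod_cast (idx j).2.le) hτ.le
  have hu : ∀ j, ‖u j‖ ≤ ρ := fun j => (hu' j).trans hτ1
  have hn' : (1 : ℝ) ≤ n := by exact_mod_cast hn
  have hρ4 : 2 * ρ ≤ 1 / 4 := by nlinarith
  have hclose : ∀ P : MvPolynomial (Fin d) ℝ, P.totalDegree ≤ n →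
      |∑ j, 1 * radial P (κ j + u j) - I P| ≤ ρ / 2 * ∑ j, 1 * ‖tGrad P (κ j)‖ := by
    intro P hP
    obtain ⟨M, hM, hs⟩ := hMZ' P hP
    simp_rw [one_mul] at hs ⊢
    have h1 : I P = ∑ j : J, radial P ((κ j : EuclideanSpace ℝ (Fin d)) + 0) := by
      rw [← hI P hP, ← hsum]
      exact Finset.sum_congr rfl fun j _ => by
        rw [add_zero, radial_of_norm_eq_one P (hy _)]
    have h2 : 0 ≤ ∑ j : J, ‖tGrad P (κ j)‖ := Finset.sum_nonneg fun _ _ => norm_nonneg _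
    rw [h1, ← Finset.sum_sub_distrib]
    calc _ ≤ ∑ j : J, gradConst A * M j * (τ * N) := by
          refine (Finset.abs_sum_le_sum_abs _ _).trans (Finset.sum_le_sum fun j _ => ?_)
          have h3 := abs_radial_sub_le_of_locBound hn (hy (κ j)) (hM j) (r := ρ) (by linarith)
            (hu j) (v' := 0) (by simpa using hρ.le)
          rw [sub_zero] at h3
          exact h3.trans (mul_le_mul_of_nonneg_left (hu' j)
            (mul_nonneg (by linarith) ((hM j).nonneg (hy (κ j)))))
      _ = gradConst A * (τ * N) * ∑ j, M j := by
          rw [Finset.mul_sum]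
          exact Finset.sum_congr rfl fun j _ => by ring
      _ ≤ gradConst A * (τ * N) * (C * ∑ j : J, ‖tGrad P (κ j)‖) :=
          mul_le_mul_of_nonneg_left hs (by positivity)
      _ ≤ _ := by
          rw [← mul_assoc]
          exact mul_le_mul_of_nonneg_right hτ2 h2
  obtain ⟨v, hv, hvI⟩ := exists_correction κ hy (fun _ => zero_le_one) hu hn hMZ' hρ hρ1 hρ2 I
    hclose
  let q : J → EuclideanSpace ℝ (Fin d) := fun j =>
    ‖(κ j : EuclideanSpace ℝ (Fin d)) + (u j + v (κ j))‖⁻¹ • (κ j + (u j + v (κ j)))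
  have huv : ∀ j, ‖u j + v (κ j)‖ ≤ 2 * ρ := fun j =>
    (norm_add_le _ _).trans (by linarith [hu j, hv (κ j)])
  have hq : ∀ j, ‖q j‖ = 1 ∧ ‖(κ j : EuclideanSpace ℝ (Fin d)) - q j‖ ≤ 4 * ρ := fun j => by
    obtain ⟨h1, h2, -⟩ := normalize_add (hy (κ j)) (by linarith) (huv j)
    exact ⟨h1, h2.trans (by linarith [huv j])⟩
  have hinj : Function.Injective q := by
    intro i j hij
    have hκ : κ i = κ j := by
      by_contra hne
      have h1 := hρ3 _ _ hne
      have h2 := norm_sub_le_norm_sub_add_norm_sub (κ i : EuclideanSpace ℝ (Fin d)) (q i) (κ j)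
      have h3 := (hq i).2
      have h4 := (hq j).2
      rw [norm_sub_rev, ← hij] at h4
      linarith
    set y := (κ j : EuclideanSpace ℝ (Fin d)) with hyj
    have h1 : ∀ l, κ l = κ j → ⟪y, q l⟫_ℝ =
        ‖(κ l : EuclideanSpace ℝ (Fin d)) + (u l + v (κ l))‖⁻¹ * (1 + ⟪y, v (κ j)⟫_ℝ) := by
      intro l hl
      simp only [q, u]
      rw [inner_smul_right, hl, inner_add_right, inner_add_right, inner_smul_right, he,
        real_inner_self_eq_norm_sq, hy]
      simp
    have h2 := h1 i hκ
    rw [hij, h1 j rfl] at h2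
    have h3 : 0 < 1 + ⟪y, v (κ j)⟫_ℝ := by
      have h4 := abs_real_inner_le_norm y (v (κ j))
      rw [hy, one_mul] at h4
      have := neg_le_of_abs_le h4
      linarith [hv (κ j)]
    have h4 := mul_right_cancel₀ h3.ne' h2
    have h5 : 0 < ‖(κ i : EuclideanSpace ℝ (Fin d)) + (u i + v (κ i))‖⁻¹ := by
      have := half_le_norm_add (hy (κ i)) (by linarith) (huv i)
      exact inv_pos.2 (by linarith)
    have h6 : u i = u j := by
      have h7 : q i = q j := hij
      simp only [q] at h7
      rw [h4] at h7
      have h8 := smul_right_injective _ h5.ne' h7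
      rw [hκ] at h8
      exact add_right_cancel (add_left_cancel h8)
    simp only [u] at h6
    rw [hκ] at h6
    have h7 : e (κ j) ≠ 0 := norm_pos_iff.1 (by rw [he1]; exact one_pos)
    have h8 := mul_left_cancel₀ hτ.ne' (smul_left_injective ℝ h7 h6)
    exact idx.injective (Fin.ext (by exact_mod_cast h8))
  refine ⟨Finset.univ.image q, ?_, ?_, fun P hP => ?_⟩
  · rw [Finset.card_image_of_injective _ hinj, Finset.card_univ, hJ]
  · intro x hx
    obtain ⟨j, -, rfl⟩ := Finset.mem_image.1 hx
    exact (hq j).1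
  · rw [Finset.sum_image hinj.injOn, ← hvI P hP]
    exact Finset.sum_congr rfl fun j _ => (one_mul _).symm

theorem massCompare_of_doubling {μ : Measure (EuclideanSpace ℝ (Fin d))} [IsProbabilityMeasure μ]
    (hμ : ∀ᵐ x ∂μ, ‖x‖ = 1) {D : ℝ}
    (hD : ∀ x, ‖x‖ = 1 → ∀ r, 0 < r →
      μ.real (Metric.closedBall x (2 * r)) ≤ D * μ.real (Metric.closedBall x r))
    {N : ℕ} (hN : 0 < N) :
    MassCompare (fun x r => N * μ.real (Metric.closedBall x r)) D := by
  have hN' : (0 : ℝ) < N := by exact_mod_cast hN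
  refine ⟨fun x hx r hr => ?_, fun x y r t h => ?_, fun x hx r hr => ?_⟩
  · refine mul_pos hN' (measureReal_nonneg.lt_of_ne fun h0 => ?_)
    have h1 : ∀ i : ℕ, μ.real (Metric.closedBall x (2 ^ i * r)) = 0 := by
      intro i
      induction i with
      | zero => simpa using h0.symm
      | succ i ih =>
        refine le_antisymm ?_ measureReal_nonneg
        have := hD x hx (2 ^ i * r) (by positivity)
        rwa [ih, mul_zero, ← mul_assoc, ← pow_succ'] at this
    obtain ⟨i, hi⟩ := pow_unbounded_of_one_lt (2 / r) (one_lt_two : (1 : ℝ) < 2)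
    have h2 : Metric.closedBall x (2 ^ i * r) =ᵐ[μ] univ := by
      refine Filter.eventuallyEq_univ.2 ?_
      filter_upwards [hμ] with y hy
      rw [Metric.mem_closedBall, dist_eq_norm]
      have h3 := (div_lt_iff₀ hr).1 hi
      have h4 := norm_sub_le y x
      linarith
    have h3 := h1 i
    rw [measureReal_congr h2, probReal_univ] at h3
    exact one_ne_zero h3
  · refine mul_le_mul_of_nonneg_left (measureReal_mono ?_) hN'.le
    exact Metric.closedBall_subset_closedBall' (by rwa [dist_eq_norm])
  · have := mul_le_mul_of_nonneg_left (hD x hx r hr) hN'.le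
    linarith

theorem exists_cubature_of_doubling (hd : 2 ≤ d) {D : ℝ} (hD : 1 ≤ D) :
    ∃ K : ℝ, 0 < K ∧ ∀ μ : Measure (EuclideanSpace ℝ (Fin d)), IsProbabilityMeasure μ →
      (∀ᵐ x ∂μ, ‖x‖ = 1) →
      (∀ x, ‖x‖ = 1 → ∀ r, 0 < r →
        μ.real (Metric.closedBall x (2 * r)) ≤ D * μ.real (Metric.closedBall x r)) →
      ∀ n N : ℕ, 0 < n →
        (∀ x, ‖x‖ = 1 → K ≤ N * μ.real (Metric.closedBall x (1 / (n : ℝ)))) →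
        ∃ Z : Finset (EuclideanSpace ℝ (Fin d)), Z.card = N ∧ (∀ x ∈ Z, ‖x‖ = 1) ∧
          ∀ P : MvPolynomial (Fin d) ℝ, P.totalDegree ≤ n →
            ∑ x ∈ Z, pEval P x = N * ∫ x, pEval P x ∂μ := by
  have hD0 : 0 < D := by linarith
  obtain ⟨A, hA⟩ := pow_unbounded_of_one_lt (2 * D) (one_lt_two : (1 : ℝ) < 2)
  have hB := one_le_bernsteinConst A
  have hG := one_le_gradConst A
  set B := bernsteinConst A with hBdef
  set G := gradConst A with hGdef
  have h2A : (1 : ℝ) ≤ 2 ^ A := one_le_pow₀ (by norm_num)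
  set η : ℝ := 1 / (4 * (B * 2 ^ A)) with hη
  have hη0 : 0 < η := by positivity
  have hη1 : 2 * (B * 2 ^ A) * η ≤ 1 / 2 := by rw [hη]; field_simp; norm_num
  have hη2 : η ≤ 1 / 2 := by
    have := one_le_mul_of_one_le_of_one_le hB h2A
    nlinarith
  obtain ⟨i, hi⟩ := pow_unbounded_of_one_lt (2 / η) (one_lt_two : (1 : ℝ) < 2)
  set c₂ : ℝ := 1 / (2 * D ^ i) with hc₂
  have hc₂0 : 0 < c₂ := by positivity
  set C : ℝ := 2 * D / c₂ * 2 ^ A * (2 * 2 ^ A * (2 * D)) with hC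
  have hC0 : 0 < C := by positivity
  obtain ⟨ε, hε0, hε1, hε2, hε3⟩ : ∃ ε : ℝ, 0 < ε ∧ 2 * ε ≤ 1 / 4 ∧ G * 2 * C * ε ≤ 1 / 2 ∧
      C * (2 * (B * 2 ^ A)) * 2 * ε ≤ 1 / 2 := by
    obtain ⟨ε, h1, h2, h3, h0⟩ := ((eventually_mul_le 2 (by norm_num : (0 : ℝ) < 1 / 4)).and
      ((eventually_mul_le (G * 2 * C) (by norm_num : (0 : ℝ) < 1 / 2)).and
      ((eventually_mul_le (C * (2 * (B * 2 ^ A)) * 2) (by norm_num : (0 : ℝ) < 1 / 2)).and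
      self_mem_nhdsWithin))).exists
    exact ⟨ε, h0, h1, h2, h3⟩
  obtain ⟨δ, hδ0, hδ1, hδ2, hδ3⟩ : ∃ δ : ℝ, 0 < δ ∧ 8 * δ ≤ 1 ∧ 2 * δ ≤ η ∧
      4 * G * C * δ ≤ ε / 2 := by
    obtain ⟨δ, h1, h2, h3, h0⟩ := ((eventually_mul_le 8 one_pos).and
      ((eventually_mul_le 2 hη0).and ((eventually_mul_le (4 * G * C) (half_pos hε0)).and
      self_mem_nhdsWithin))).exists
    exact ⟨δ, h0, h1, h2, h3⟩
  obtain ⟨j, hj⟩ := pow_unbounded_of_one_lt (3 / δ) (one_lt_two : (1 : ℝ) < 2)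
  refine ⟨2 * D ^ j, by positivity, fun μ _ hμ hdoub n N hn hN => ?_⟩
  have hn' : (0 : ℝ) < n := by exact_mod_cast hn
  have hN0 : 0 < N := by
    refine Nat.pos_of_ne_zero fun h0 => ?_
    have h1 := hN (EuclideanSpace.single ⟨0, by omega⟩ 1) (by simp)
    rw [h0, Nat.cast_zero, zero_mul] at h1
    have : 0 < 2 * D ^ j := by positivity
    linarith
  have hβ := massCompare_of_doubling hμ hdoub hN0
  set β : EuclideanSpace ℝ (Fin d) → ℝ → ℝ := fun x r => N * μ.real (Metric.closedBall x r) with hβd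
  have hβr : ∀ x (r t : ℝ), r ≤ t → β x r ≤ β x t := fun x r t h =>
    hβ.mono x x r t (by simpa using h)
  set s := δ / n with hs
  have hs0 : 0 < s := by positivity
  have hmass : ∀ x, ‖x‖ = 1 → 2 ≤ N * μ.real (Metric.closedBall x (s / 3)) := by
    intro x hx
    have h1 := hβ.doubling_pow hD0.le hx (r := s / 3) (by positivity) j
    have h2 : β x (1 / (n : ℝ)) ≤ β x (2 ^ j * (s / 3)) := hβr _ _ _ (by
      have h3 := (div_lt_iff₀ hδ0).1 hj
      rw [hs, div_div, ← mul_div_assoc, div_le_div_iff₀ hn' (by positivity)]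
      nlinarith)
    have h3 : 2 * D ^ j ≤ D ^ j * β x (s / 3) := (hN x hx).trans (h2.trans h1)
    rw [mul_comm] at h3
    exact le_of_mul_le_mul_left h3 (by positivity)
  obtain ⟨m, ξ, a, hξ, ha, hup, hlow, hdisc⟩ := exists_discretization hd hμ hs0 hmass
  have hsn : n * s = δ := by rw [hs]; field_simp
  have hMZ : GradMZ A n C (fun k => (a k : ℝ)) ξ := by
    refine hβ.gradMZ hD0.le hn hA.le (fun k => Nat.cast_nonneg _) hξ (by positivity) hc₂0 hη2 hη1
      (fun y hy r hr => ?_) fun y hy => ?_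
    · refine (hup y r).trans ?_
      have h1 : β y (r + 3 * s) ≤ β y (2 * r) := hβr _ _ _ (by
        have : 3 * s ≤ 1 / (n : ℝ) := by
          rw [le_div_iff₀ hn']
          linarith
        linarith)
      have h2 := hβ.doubling y hy r (lt_of_lt_of_le (by positivity) hr)
      change 2 * β y (r + 3 * s) ≤ _
      linarith
    · refine le_trans ?_ (hlow y (η / n))
      have h0 : η / (2 * n) ≤ η / n - s := by
        rw [hs, ← sub_div, div_le_div_iff₀ (by positivity) hn']
        nlinarith
      have h1 := hβ.doubling_pow hD0.le hy (r := η / n - s)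
        (lt_of_lt_of_le (by positivity) h0) i
      have h2 : β y (1 / (n : ℝ)) ≤ β y (2 ^ i * (η / n - s)) := hβr _ _ _ (by
        refine le_trans ?_ (mul_le_mul_of_nonneg_left h0 (by positivity))
        have h3 := (div_lt_iff₀ hη0).1 hi
        rw [← mul_div_assoc, div_le_div_iff₀ hn' (by positivity)]
        nlinarith)
      change c₂ * β y (1 / (n : ℝ)) ≤ β y (η / n - s) / 2
      calc c₂ * β y (1 / (n : ℝ)) ≤ c₂ * (D ^ i * β y (η / n - s)) :=
            mul_le_mul_of_nonneg_left (h2.trans h1) hc₂0.le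
        _ = _ := by rw [hc₂]; field_simp
  let I : MvPolynomial (Fin d) ℝ →ₗ[ℝ] ℝ :=
    { toFun := fun P => N * ∫ x, pEval P x ∂μ
      map_add' := fun P Q => by
        simp_rw [pEval_add]
        rw [integral_add (integrable_pEval hμ P) (integrable_pEval hμ Q), mul_add]
      map_smul' := fun t P => by
        simp_rw [pEval_smul]
        rw [integral_const_mul, RingHom.id_apply, smul_eq_mul]
        ring }
  set ρ := ε / n with hρ
  have hρ0 : 0 < ρ := by positivity
  have hρn : n * ρ = ε := by rw [hρ]; field_simp
  have hclose : ∀ P : MvPolynomial (Fin d) ℝ, P.totalDegree ≤ n →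
      |∑ k, (a k : ℝ) * radial P (ξ (id k) + 0) - I P| ≤
        ρ / 2 * ∑ k, (a k : ℝ) * ‖tGrad P (ξ (id k))‖ := by
    intro P hP
    obtain ⟨M, hM, hMs⟩ := hMZ P hP
    have h1 := hdisc A n P M hn (by linarith) hM
    have h2 : 0 ≤ ∑ k, (a k : ℝ) * ‖tGrad P (ξ k)‖ :=
      Finset.sum_nonneg fun k _ => by positivity
    simp_rw [id, add_zero, radial_of_norm_eq_one P (hξ _)]
    refine h1.trans ((mul_le_mul_of_nonneg_left hMs (by positivity)).trans ?_)
    rw [← mul_assoc]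
    refine mul_le_mul_of_nonneg_right ?_ h2
    rw [hs, hρ, div_div, mul_comm (n : ℝ), ← div_div]
    calc 4 * gradConst A * (δ / n) * C = 4 * G * C * δ / n := by rw [hGdef]; ring
      _ ≤ _ := div_le_div_of_nonneg_right hδ3 hn'.le
  obtain ⟨v, hv, hvI⟩ := exists_correction id hξ (fun k => Nat.cast_nonneg (a k))
    (u := fun _ => 0) (fun _ => by simpa using hρ0.le) hn hMZ hρ0 (by linarith)
    (by calc G * n * (2 * ρ) * C = G * 2 * C * (n * ρ) := by ring
          _ ≤ _ := by rw [hρn]; exact hε2) I hclose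
  set z : Fin m → EuclideanSpace ℝ (Fin d) := fun k => ‖ξ k + v k‖⁻¹ • (ξ k + v k) with hz
  have hn1 : (1 : ℝ) ≤ n := by exact_mod_cast hn
  have hρ1 : ρ ≤ 1 / 2 := by nlinarith
  have hz1 : ∀ k, ‖z k‖ = 1 := fun k => (normalize_add (hξ k) hρ1 (hv k)).1
  have hMZz := hMZ.perturb hn hC0.le (fun k => Nat.cast_nonneg (a k)) hξ hz1 (r := 2 * ρ)
    (fun k => (normalize_add (hξ k) hρ1 (hv k)).2.1.trans (by linarith [hv k])) (by linarith)
    (by calc C * (2 * (B * 2 ^ A) * (n * (2 * ρ))) = C * (2 * (B * 2 ^ A)) * 2 * (n * ρ) := by ring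
          _ ≤ _ := by rw [hρn]; exact hε3)
  exact exists_distinct_nodes hd hn hz1 ha hMZz I fun P hP => by
    rw [← hvI P hP]
    simp [z, radial]

theorem norm_sub_eq_two_mul_sin {x y : EuclideanSpace ℝ (Fin d)} (hx : ‖x‖ = 1) (hy : ‖y‖ = 1) :
    ‖x - y‖ = 2 * sin (gdist x y / 2) := by
  have h0 : 0 ≤ gdist x y := arccos_nonneg _
  have h1 : gdist x y ≤ π := arccos_le_pi _
  have h2 : cos (gdist x y) = ⟪x, y⟫_ℝ := by
    have h3 := abs_le.1 (abs_real_inner_le_norm x y)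
    rw [hx, hy, one_mul] at h3
    exact cos_arccos h3.1 h3.2
  have h4 : 0 ≤ sin (gdist x y / 2) := sin_nonneg_of_nonneg_of_le_pi (by linarith) (by linarith)
  have h5 : cos (gdist x y) = 1 - 2 * sin (gdist x y / 2) ^ 2 := by
    have := cos_two_mul (gdist x y / 2)
    rw [mul_div_cancel₀ _ (two_ne_zero' ℝ), cos_sq'] at this
    linarith
  rw [← sq_eq_sq₀ (norm_nonneg _) (by positivity), norm_sub_sq_real, hx, hy, ← h2, h5]
  ring

theorem norm_sub_le_gdist {x y : EuclideanSpace ℝ (Fin d)} (hx : ‖x‖ = 1) (hy : ‖y‖ = 1) :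
    ‖x - y‖ ≤ gdist x y := by
  rw [norm_sub_eq_two_mul_sin hx hy]
  have h0 : 0 ≤ gdist x y := arccos_nonneg _
  have := sin_le (by positivity : 0 ≤ gdist x y / 2)
  linarith

theorem gdist_le_two_mul_norm_sub {x y : EuclideanSpace ℝ (Fin d)} (hx : ‖x‖ = 1)
    (hy : ‖y‖ = 1) : gdist x y ≤ 2 * ‖x - y‖ := by
  rw [norm_sub_eq_two_mul_sin hx hy]
  have h0 : 0 ≤ gdist x y := arccos_nonneg _
  have h1 : gdist x y ≤ π := arccos_le_pi _
  have h2 := mul_le_sin (by positivity : 0 ≤ gdist x y / 2) (by linarith)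
  have h3 : 1 / 2 * (gdist x y / 2) ≤ 2 / π * (gdist x y / 2) := by
    refine mul_le_mul_of_nonneg_right ?_ (by positivity)
    rw [div_le_div_iff₀ two_pos pi_pos]
    linarith [pi_le_four]
  linarith

theorem measurableSet_cap (x : EuclideanSpace ℝ (Fin d)) (r : ℝ) : MeasurableSet (cap x r) := by
  have h : IsClosed {y : EuclideanSpace ℝ (Fin d) | gdist x y ≤ r} :=
    isClosed_le (continuous_arccos.comp (by fun_prop)) continuous_const
  exact Metric.isClosed_sphere.measurableSet.inter h.measurableSet

theorem ae_sphMeasure_norm_eq_one : ∀ᵐ x ∂sphMeasure d, ‖x‖ = 1 := by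
  have h : MeasurableSet (unitSphere d) := Metric.isClosed_sphere.measurableSet
  filter_upwards [ae_restrict_mem h] with x hx
  simpa [unitSphere] using hx

/-- Chebyshev-type cubature formulas of any admissible size exist for
doubling weights on the sphere. -/
theorem chebyshev_cubature_doubling_weight (d : ℕ) (hd : 2 ≤ d) (L : ℝ) :
    ∃ K : ℝ, 0 < K ∧
      ∀ w : EuclideanSpace ℝ (Fin d) → ℝ,
        (∀ x, 0 ≤ w x) →
        Integrable w (sphMeasure d) →
        wMass w (unitSphere d) = 1 →
        (∀ x ∈ unitSphere d, ∀ r : ℝ, 0 < r →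
          wMass w (cap x (2 * r)) ≤ L * wMass w (cap x r)) →
        ∀ n N : ℕ, 0 < n →
          (∀ x ∈ unitSphere d, K ≤ (N : ℝ) * wMass w (cap x (1 / (n : ℝ)))) →
          ∃ Z : Finset (EuclideanSpace ℝ (Fin d)), Z.card = N ∧
            (↑Z : Set (EuclideanSpace ℝ (Fin d))) ⊆ unitSphere d ∧
            ∀ P : MvPolynomial (Fin d) ℝ, P.totalDegree ≤ n →
              (∫ x, pEval P x * w x ∂(sphMeasure d))
                = (1 / (N : ℝ)) * ∑ z ∈ Z, pEval P z := by
  have hL1 : 1 ≤ max L 1 := le_max_right _ _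
  obtain ⟨K, hK, h⟩ := exists_cubature_of_doubling hd (one_le_pow₀ hL1 (n := 2))
  refine ⟨K, hK, fun w hw hwi hw1 hdoub n N hn hN => ?_⟩
  have hunit : ∀ x : EuclideanSpace ℝ (Fin d), x ∈ unitSphere d ↔ ‖x‖ = 1 := fun x => by
    simp [unitSphere]
  set μ := (sphMeasure d).withDensity fun x => ENNReal.ofReal (w x) with hμdef
  have hmass : ∀ S, MeasurableSet S → μ.real S = wMass w S := fun S hS => by
    rw [measureReal_def, hμdef, withDensity_apply _ hS, wMass,
      integral_eq_lintegral_of_nonneg_ae (Filter.Eventually.of_forall hw)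
        hwi.aestronglyMeasurable.restrict]
  have hfin : IsFiniteMeasure μ := isFiniteMeasure_withDensity_ofReal hwi.2
  have hμ : ∀ᵐ x ∂μ, ‖x‖ = 1 := (withDensity_absolutelyContinuous _ _) ae_sphMeasure_norm_eq_one
  have hprob : IsProbabilityMeasure μ := by
    have h1 : unitSphere d =ᵐ[μ] univ := Filter.eventuallyEq_univ.2 (by
      filter_upwards [hμ] with x hx using (hunit x).2 hx)
    have h2 := hmass (unitSphere d) Metric.isClosed_sphere.measurableSet
    rw [hw1, measureReal_congr h1] at h2
    exact (isProbabilityMeasure_iff_real).2 h2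
  have hcap : ∀ x, ‖x‖ = 1 → ∀ r, μ.real (cap x r) ≤ μ.real (Metric.closedBall x r) :=
    fun x hx r => measureReal_mono fun y hy => by
      rw [Metric.mem_closedBall, dist_comm, dist_eq_norm]
      exact (norm_sub_le_gdist hx ((hunit y).1 hy.1)).trans hy.2
  have hball : ∀ x, ‖x‖ = 1 → ∀ r, μ.real (Metric.closedBall x r) ≤ μ.real (cap x (2 * r)) :=
    fun x hx r => by
      refine ENNReal.toReal_mono (measure_ne_top _ _) (measure_mono_ae ?_)
      filter_upwards [hμ] with y hy hyr
      have h1 : ‖x - y‖ ≤ r := by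
        rw [← dist_eq_norm, dist_comm]
        exact hyr
      exact ⟨(hunit y).2 hy, (gdist_le_two_mul_norm_sub hx hy).trans (by linarith)⟩
  have hcap2 : ∀ x, ‖x‖ = 1 → ∀ r, 0 < r →
      μ.real (cap x (2 * r)) ≤ max L 1 * μ.real (cap x r) := fun x hx r hr => by
    have h1 := hdoub x ((hunit x).2 hx) r hr
    rw [← hmass _ (measurableSet_cap _ _), ← hmass _ (measurableSet_cap _ _)] at h1
    exact h1.trans (mul_le_mul_of_nonneg_right (le_max_left _ _) measureReal_nonneg)
  obtain ⟨Z, hZ, hZ1, hZP⟩ := h μ hprob hμ (fun x hx r hr => by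
      have h1 := hcap2 x hx (2 * r) (by positivity)
      have h2 := mul_le_mul_of_nonneg_left (hcap2 x hx r hr) (by linarith : 0 ≤ max L 1)
      have h3 := mul_le_mul_of_nonneg_left (hcap x hx r) (by positivity : 0 ≤ max L 1 ^ 2)
      have h4 := hball x hx (2 * r)
      nlinarith) n N hn fun x hx => by
      refine (hN x ((hunit x).2 hx)).trans ?_
      rw [← hmass _ (measurableSet_cap _ _)]
      exact mul_le_mul_of_nonneg_left (hcap x hx _) (Nat.cast_nonneg N)
  have hN0 : (N : ℝ) ≠ 0 := fun h0 => by
    have h1 := hN (EuclideanSpace.single ⟨0, by omega⟩ 1) ((hunit _).2 (by simp))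
    rw [h0, zero_mul] at h1
    linarith
  refine ⟨Z, hZ, fun x hx => (hunit x).2 (hZ1 x hx), fun P hP => ?_⟩
  rw [hZP P hP, one_div, inv_mul_cancel_left₀ hN0, hμdef,
    integral_withDensity_eq_integral_toReal_smul₀ hwi.aemeasurable.ennreal_ofReal
      (Filter.Eventually.of_forall fun _ => ENNReal.ofReal_lt_top)]
  refine integral_congr_ae (Filter.Eventually.of_forall fun x => ?_)
  simp [ENNReal.toReal_ofReal (hw x), mul_comm]
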